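/- arXiv:math/0305410 — 3 statements merged into one kernel-verified Lean document; each statement's English description precedes it below -/
import Mathlib

section
/- For every 1 ≤ p < q < ∞ there exists a constant c_{p,q} > 0 with the following property: for every n and every symmetric convex body K in ℝⁿ, ‖V_K‖_p^{1/n} ≤ ‖V_K‖_q^{1/n} ≤ c_{p,q} ‖V_K‖_p^{1/n}, and for every convex body K in ℝⁿ, ‖U_K‖_p^{1/n} ≤ ‖U_K‖_q^{1/n} ≤ c_{p,q} ‖U_K‖_p^{1/n}. -/
open MeasureTheory Pointwise

/-- The uniform probability measure on a set `K` in `ℝⁿ`. -/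
noncomputable def unifMeasure (n : ℕ) (K : Set (EuclideanSpace ℝ (Fin n))) :
    Measure (EuclideanSpace ℝ (Fin n)) :=
  (volume K)⁻¹ • volume.restrict K

/-- The joint distribution of `N` independent uniform random points in `K`. -/
noncomputable def jointUnif (n N : ℕ) (K : Set (EuclideanSpace ℝ (Fin n))) :
    Measure (Fin N → EuclideanSpace ℝ (Fin n)) :=
  Measure.pi fun _ => unifMeasure n K

/-- `U_K`: the normalized volume of the convex hull of `n+1` points. -/
noncomputable def randSimplexVol (n : ℕ) (K : Set (EuclideanSpace ℝ (Fin n)))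
    (x : Fin (n + 1) → EuclideanSpace ℝ (Fin n)) : ℝ :=
  (volume (convexHull ℝ (Set.range x))).toReal / (volume K).toReal

/-- `V_K`: the normalized volume of the symmetric convex hull of `n` points. -/
noncomputable def randCrossVol (n : ℕ) (K : Set (EuclideanSpace ℝ (Fin n)))
    (x : Fin n → EuclideanSpace ℝ (Fin n)) : ℝ :=
  (volume (convexHull ℝ (Set.range x ∪ -Set.range x))).toReal / (volume K).toReal

/-- `‖U_K‖_p`, the `p`-th moment norm of the normalized volume of a random simplex in `K`. -/
noncomputable def lpNormU (n : ℕ) (K : Set (EuclideanSpace ℝ (Fin n))) (p : ℝ) : ℝ :=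
  (∫ x, |randSimplexVol n K x| ^ p ∂(jointUnif n (n + 1) K)) ^ (1 / p)

/-- `‖V_K‖_p`, the `p`-th moment norm of the normalized volume of a random
crosspolytope in `K`. -/
noncomputable def lpNormV (n : ℕ) (K : Set (EuclideanSpace ℝ (Fin n))) (p : ℝ) : ℝ :=
  (∫ x, |randCrossVol n K x| ^ p ∂(jointUnif n n K)) ^ (1 / p)

open scoped ENNReal

/-- The midpoint form of the Prékopa–Leindler inequality for a measure `μ`. -/
def MidpointPrekopaLeindler {E : Type*} [AddCommGroup E] [Module ℝ E] [MeasurableSpace E]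
    (μ : Measure E) : Prop :=
  ∀ f g h : E → ℝ≥0∞, Measurable f → Measurable g → Measurable h →
    (∀ x y, f x * g y ≤ h ((2⁻¹ : ℝ) • (x + y)) ^ 2) →
      (∫⁻ x, f x ∂μ) * (∫⁻ x, g x ∂μ) ≤ (∫⁻ x, h x ∂μ) ^ 2

lemma volume_add_le_of_isCompact {A B C : Set ℝ} (hA : IsCompact A) (hB : IsCompact B)
    (hA₀ : A.Nonempty) (hB₀ : B.Nonempty)
    (h : ∀ a ∈ A, ∀ b ∈ B, (2⁻¹ : ℝ) • (a + b) ∈ C) :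
    volume A + volume B ≤ 2 * volume C := by
  obtain ⟨a, haA, ha⟩ := hA.exists_isGreatest hA₀
  obtain ⟨b, hbB, hb⟩ := hB.exists_isLeast hB₀
  set m : ℝ := 2⁻¹ * (a + b) with hm
  have vol : ∀ (x : ℝ) (s : Set ℝ), 2 * volume (AffineMap.homothety x (2⁻¹ : ℝ) '' s)
      = volume s := by
    intro x s
    rw [Measure.addHaar_image_homothety, ← mul_assoc]
    have : (2 : ℝ≥0∞) * ENNReal.ofReal |(2⁻¹ : ℝ) ^ Module.finrank ℝ ℝ| = 1 := by
      rw [show (2 : ℝ≥0∞) = ENNReal.ofReal 2 by simp, ← ENNReal.ofReal_mul (by norm_num)]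
      simp
    rw [this, one_mul]
  have h1 : volume (AffineMap.homothety b (2⁻¹ : ℝ) '' A) ≤ volume (C ∩ Set.Iic m) := by
    apply measure_mono
    rintro _ ⟨x, hx, rfl⟩
    have e : AffineMap.homothety b (2⁻¹ : ℝ) x = 2⁻¹ * (x + b) := by
      simp [AffineMap.homothety_apply]; ring
    rw [e]
    refine ⟨h x hx b hbB, ?_⟩
    have := ha hx
    simp only [Set.mem_Iic, hm]; linarith
  have h2 : volume (AffineMap.homothety a (2⁻¹ : ℝ) '' B) ≤ volume (C \ Set.Iic m) := by
    rw [← measure_sdiff_null (t := {m}) (by simp)]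
    apply measure_mono
    rintro _ ⟨⟨x, hx, rfl⟩, hne⟩
    have e : AffineMap.homothety a (2⁻¹ : ℝ) x = 2⁻¹ * (a + x) := by
      simp [AffineMap.homothety_apply]; ring
    rw [e] at hne ⊢
    refine ⟨h a haA x hx, ?_⟩
    have := hb hx
    simp only [Set.mem_Iic, not_le]
    refine lt_of_le_of_ne ?_ (fun h' => hne h'.symm)
    simp only [hm]; linarith
  rw [← vol b A, ← vol a B, ← mul_add, ← measure_inter_add_sdiff C (measurableSet_Iic (a := m))]
  gcongr

lemma volume_add_le {A B C : Set ℝ} (hA : MeasurableSet A) (hB : MeasurableSet B)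
    (hA₀ : A.Nonempty) (hB₀ : B.Nonempty)
    (h : ∀ a ∈ A, ∀ b ∈ B, (2⁻¹ : ℝ) • (a + b) ∈ C) :
    volume A + volume B ≤ 2 * volume C := by
  obtain ⟨a, ha⟩ := hA₀
  obtain ⟨b, hb⟩ := hB₀
  have key : ∀ K ⊆ A, IsCompact K → ∀ K' ⊆ B, IsCompact K' →
      volume K + volume K' ≤ 2 * volume C := by
    intro K hK hKc K' hK' hKc'
    refine le_trans (add_le_add (measure_mono (Set.subset_insert a K))
      (measure_mono (Set.subset_insert b K'))) ?_
    refine volume_add_le_of_isCompact (hKc.insert a) (hKc'.insert b) (Set.insert_nonempty _ _)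
      (Set.insert_nonempty _ _) ?_
    intro x hx y hy
    exact h x (Set.insert_subset ha hK hx) y (Set.insert_subset hb hK' hy)
  have := ENNReal.biSup_add_biSup_le' (p := fun K => K ⊆ A ∧ IsCompact K)
    (q := fun K => K ⊆ B ∧ IsCompact K) ⟨∅, by simp⟩ ⟨∅, by simp⟩
    fun K hK K' hK' => key K hK.1 hK.2 K' hK'.1 hK'.2
  rw [hA.measure_eq_iSup_isCompact, hB.measure_eq_iSup_isCompact]
  simpa only [iSup_and] using this

lemma lintegral_add_le_of_iSup_eq_one {f g h : ℝ → ℝ≥0∞} (hf : Measurable f) (hg : Measurable g)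
    (hh : Measurable h) (hf₁ : ⨆ x, f x = 1) (hg₁ : ⨆ x, g x = 1)
    (H : ∀ x y, f x * g y ≤ h ((2⁻¹ : ℝ) • (x + y)) ^ 2) :
    (∫⁻ x, f x) + (∫⁻ x, g x) ≤ 2 * ∫⁻ x, h x := by
  have hf' : ∀ x, f x ≤ 1 := fun x => hf₁ ▸ le_iSup f x
  have hg' : ∀ x, g x ≤ 1 := fun x => hg₁ ▸ le_iSup g x
  have layer : ∀ u : ℝ → ℝ≥0∞, Measurable u → (∀ x, u x ≤ 1) →
      ∫⁻ x, u x = ∫⁻ t in Set.Ioi 0, volume {x | t < (u x).toReal} := by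
    intro u hu hu1
    rw [← lintegral_eq_lintegral_meas_lt volume (by filter_upwards with x using by simp)
      hu.ennreal_toReal.aemeasurable]
    congr 1 with x
    rw [ENNReal.ofReal_toReal (ne_top_of_le_ne_top ENNReal.one_ne_top (hu1 x))]
  set k : ℝ → ℝ≥0∞ := fun x => min (h x) 1 with hk
  have hkm : Measurable k := hh.min measurable_const
  have hk' : ∀ x, k x ≤ 1 := fun x => min_le_right _ _
  have Hk : ∀ x y, f x * g y ≤ k ((2⁻¹ : ℝ) • (x + y)) ^ 2 := by
    intro x y
    rcases le_total (h ((2⁻¹ : ℝ) • (x + y))) 1 with h1 | h1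
    · simpa only [hk, min_eq_left h1] using H x y
    · simp only [hk, min_eq_right h1]
      simpa using mul_le_mul' (hf' x) (hg' y)
  have fin : ∀ u : ℝ → ℝ≥0∞, (∀ x, u x ≤ 1) → ∀ x, u x ≠ ⊤ := fun u hu x =>
    ne_top_of_le_ne_top ENNReal.one_ne_top (hu x)
  have HR : ∀ x y, (f x).toReal * (g y).toReal ≤ (k ((2⁻¹ : ℝ) • (x + y))).toReal ^ 2 := by
    intro x y
    rw [← ENNReal.toReal_mul, ← ENNReal.toReal_pow]
    exact ENNReal.toReal_mono (ENNReal.pow_ne_top (fin k hk' _)) (Hk x y)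
  have hlt : ∀ u : ℝ → ℝ≥0∞, (∀ x, u x ≤ 1) → (⨆ x, u x = 1) → ∀ t : ℝ, 0 < t → t < 1 →
      {x | t < (u x).toReal}.Nonempty := by
    intro u hu hu1 t ht0 ht
    have : ENNReal.ofReal t < ⨆ x, u x := by rw [hu1]; simpa using ht
    obtain ⟨x, hx⟩ := lt_iSup_iff.1 this
    exact ⟨x, (ENNReal.ofReal_lt_iff_lt_toReal ht0.le (fin u hu x)).1 hx⟩
  have hge : ∀ u : ℝ → ℝ≥0∞, (∀ x, u x ≤ 1) → ∀ t : ℝ, 1 ≤ t →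
      {x | t < (u x).toReal} = ∅ := by
    intro u hu t ht
    ext x
    have : (u x).toReal ≤ 1 := by
      simpa using ENNReal.toReal_mono ENNReal.one_ne_top (hu x)
    simp only [Set.mem_ofPred_eq, Set.mem_empty_iff_false, iff_false, not_lt]; linarith
  have hmeas : ∀ u : ℝ → ℝ≥0∞, Measurable u →
      Measurable fun t : ℝ => volume {x | t < (u x).toReal} := by
    intro u hu
    refine Antitone.measurable fun s t hst => measure_mono fun x hx => lt_of_le_of_lt hst hx
  calc (∫⁻ x, f x) + (∫⁻ x, g x)
      = ∫⁻ t in Set.Ioi (0 : ℝ),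
          (volume {x | t < (f x).toReal} + volume {x | t < (g x).toReal}) := by
        rw [layer f hf hf', layer g hg hg', lintegral_add_left (hmeas f hf)]
    _ ≤ ∫⁻ t in Set.Ioi (0 : ℝ), 2 * volume {x | t < (k x).toReal} := by
        refine setLIntegral_mono ((hmeas k hkm).const_mul 2) fun t ht => ?_
        have ht : 0 < t := ht
        rcases lt_or_ge t 1 with h1 | h1
        · refine volume_add_le (measurableSet_lt measurable_const hf.ennreal_toReal)
            (measurableSet_lt measurable_const hg.ennreal_toReal) (hlt f hf' hf₁ t ht h1)
            (hlt g hg' hg₁ t ht h1) ?_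
          intro a ha b hb
          have ha : t < (f a).toReal := ha
          have hb : t < (g b).toReal := hb
          have := HR a b
          refine lt_of_pow_lt_pow_left₀ 2 ENNReal.toReal_nonneg (lt_of_lt_of_le ?_ this)
          nlinarith
        · simp [hge f hf' t h1, hge g hg' t h1]
    _ = 2 * ∫⁻ x, k x := by
        rw [lintegral_const_mul _ (hmeas k hkm), layer k hkm hk']
    _ ≤ 2 * ∫⁻ x, h x := by
        gcongr with x
        exact min_le_left _ _

lemma ENNReal.mul_le_sq_of_add_le_two_mul {a b c : ℝ≥0∞} (h : a + b ≤ 2 * c) :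
    a * b ≤ c ^ 2 := by
  rcases eq_or_ne c ⊤ with rfl | hc
  · simp
  have hab : a + b ≠ ⊤ := ne_top_of_le_ne_top (ENNReal.mul_ne_top (by simp) hc) h
  lift c to NNReal using hc
  lift a to NNReal using fun h' => hab (by simp [h'])
  lift b to NNReal using fun h' => hab (by simp [h'])
  norm_cast at h ⊢
  have h' : (a : ℝ) + b ≤ 2 * c := by exact_mod_cast h
  have h'' := mul_self_le_mul_self (by positivity : (0 : ℝ) ≤ a + b) h'
  have : (a : ℝ) * b ≤ c ^ 2 := by nlinarith [sq_nonneg ((a : ℝ) - b)]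
  exact_mod_cast this

lemma lintegral_mul_le_of_bounded {f g h : ℝ → ℝ≥0∞} (hf : Measurable f) (hg : Measurable g)
    (hh : Measurable h) (hf₁ : ⨆ x, f x ≠ ⊤) (hg₁ : ⨆ x, g x ≠ ⊤)
    (H : ∀ x y, f x * g y ≤ h ((2⁻¹ : ℝ) • (x + y)) ^ 2) :
    (∫⁻ x, f x) * (∫⁻ x, g x) ≤ (∫⁻ x, h x) ^ 2 := by
  rcases eq_or_ne (⨆ x, f x) 0 with h0 | hf₀
  · have : ∀ x, f x = 0 := fun x => le_antisymm (h0 ▸ le_iSup f x) zero_le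
    simp [this]
  rcases eq_or_ne (⨆ x, g x) 0 with h0 | hg₀
  · have : ∀ x, g x = 0 := fun x => le_antisymm (h0 ▸ le_iSup g x) zero_le
    simp [this]
  set a := ⨆ x, f x with ha
  set b := ⨆ x, g x with hb
  obtain ⟨s, hs⟩ : ∃ s : ℝ≥0∞, s ^ 2 = a * b := by
    refine ⟨(a * b) ^ (2⁻¹ : ℝ), ?_⟩
    rw [← ENNReal.rpow_natCast, ← ENNReal.rpow_mul]; norm_num
  have hs0 : s ≠ 0 := by rintro rfl; simp [hf₀, hg₀] at hs
  have hst : s ≠ ⊤ := by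
    rintro rfl
    exact ENNReal.mul_ne_top hf₁ hg₁ (by rw [← hs]; simp)
  have key := lintegral_add_le_of_iSup_eq_one (hf.const_mul a⁻¹) (hg.const_mul b⁻¹)
    (hh.const_mul s⁻¹) (by rw [← ENNReal.mul_iSup, ENNReal.inv_mul_cancel hf₀ hf₁])
    (by rw [← ENNReal.mul_iSup, ENNReal.inv_mul_cancel hg₀ hg₁]) (by
      intro x y
      calc a⁻¹ * f x * (b⁻¹ * g y) = (a * b)⁻¹ * (f x * g y) := by
            rw [ENNReal.mul_inv (Or.inl hf₀) (Or.inl hf₁)]; ring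
        _ ≤ (s ^ 2)⁻¹ * h ((2⁻¹ : ℝ) • (x + y)) ^ 2 := by rw [hs]; gcongr; exact H x y
        _ = _ := by rw [mul_pow, ENNReal.inv_pow])
  rw [lintegral_const_mul _ hf, lintegral_const_mul _ hg, lintegral_const_mul _ hh] at key
  have key2 := ENNReal.mul_le_sq_of_add_le_two_mul key
  calc (∫⁻ x, f x) * (∫⁻ x, g x)
      = (a * a⁻¹ * (b * b⁻¹)) * ((∫⁻ x, f x) * (∫⁻ x, g x)) := by
        rw [ENNReal.mul_inv_cancel hf₀ hf₁, ENNReal.mul_inv_cancel hg₀ hg₁]; simp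
    _ = s ^ 2 * (a⁻¹ * (∫⁻ x, f x) * (b⁻¹ * ∫⁻ x, g x)) := by rw [hs]; ring
    _ ≤ s ^ 2 * (s⁻¹ * ∫⁻ x, h x) ^ 2 := by gcongr
    _ = (s * s⁻¹) ^ 2 * (∫⁻ x, h x) ^ 2 := by ring
    _ = _ := by rw [ENNReal.mul_inv_cancel hs0 hst]; simp

lemma lintegral_eq_iSup_lintegral_min {α : Type*} [MeasurableSpace α] {μ : Measure α}
    {f : α → ℝ≥0∞} (hf : Measurable f) :
    ∫⁻ x, f x ∂μ = ⨆ k : ℕ, ∫⁻ x, min (f x) k ∂μ := by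
  rw [← lintegral_iSup (fun k => hf.min measurable_const)
    (fun i j hij x => min_le_min le_rfl (by exact_mod_cast hij))]
  congr 1 with x
  rw [← inf_iSup_eq, ENNReal.iSup_natCast, inf_top_eq]

lemma midpointPrekopaLeindler_real : MidpointPrekopaLeindler (volume : Measure ℝ) := by
  intro f g h hf hg hh H
  rw [lintegral_eq_iSup_lintegral_min hf, lintegral_eq_iSup_lintegral_min hg]
  simp only [ENNReal.iSup_mul, ENNReal.mul_iSup, iSup_le_iff]
  intro i j
  refine lintegral_mul_le_of_bounded (hf.min measurable_const) (hg.min measurable_const) hh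
    ?_ ?_ fun x y => (mul_le_mul' (min_le_left _ _) (min_le_left _ _)).trans (H x y)
  · exact ne_top_of_le_ne_top (ENNReal.natCast_ne_top j) (iSup_le fun x => min_le_right _ _)
  · exact ne_top_of_le_ne_top (ENNReal.natCast_ne_top i) (iSup_le fun x => min_le_right _ _)

lemma MidpointPrekopaLeindler.prod {E F : Type*} [AddCommGroup E] [Module ℝ E]
    [MeasurableSpace E] [AddCommGroup F] [Module ℝ F] [MeasurableSpace F]
    {μ : Measure E} {ν : Measure F} [SFinite μ] [SFinite ν]
    (hμ : MidpointPrekopaLeindler μ) (hν : MidpointPrekopaLeindler ν) :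
    MidpointPrekopaLeindler (μ.prod ν) := by
  intro f g h hf hg hh H
  rw [lintegral_prod _ hf.aemeasurable, lintegral_prod _ hg.aemeasurable,
    lintegral_prod _ hh.aemeasurable]
  refine hμ _ _ _ hf.lintegral_prod_right' hg.lintegral_prod_right' hh.lintegral_prod_right'
    fun x x' => ?_
  exact hν _ _ _ (hf.comp measurable_prodMk_left) (hg.comp measurable_prodMk_left)
    (hh.comp measurable_prodMk_left) fun y y' => H (x, y) (x', y')

lemma MidpointPrekopaLeindler.of_measurePreserving {E F : Type*} [AddCommGroup E] [Module ℝ E]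
    [MeasurableSpace E] [AddCommGroup F] [Module ℝ F] [MeasurableSpace F]
    {μ : Measure E} {ν : Measure F} (hμ : MidpointPrekopaLeindler μ) (e : E →ₗ[ℝ] F)
    (he : MeasurePreserving e μ ν) : MidpointPrekopaLeindler ν := by
  intro f g h hf hg hh H
  rw [← he.lintegral_comp hf, ← he.lintegral_comp hg, ← he.lintegral_comp hh]
  refine hμ _ _ _ (hf.comp he.measurable) (hg.comp he.measurable) (hh.comp he.measurable)
    fun x y => ?_
  simpa using H (e x) (e y)

lemma midpointPrekopaLeindler_pi (n : ℕ) :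
    MidpointPrekopaLeindler (volume : Measure (Fin n → ℝ)) := by
  induction n with
  | zero =>
    intro f g h hf hg hh H
    have key : ∀ u : (Fin 0 → ℝ) → ℝ≥0∞, ∫⁻ x, u x = u 0 := by
      intro u
      rw [lintegral_unique, volume_pi, Measure.pi_of_empty]
      simp only [measure_univ, mul_one]
      congr 1
      exact Subsingleton.elim _ _
    simpa [key] using H 0 0
  | succ n ih =>
    refine (midpointPrekopaLeindler_real.prod ih).of_measurePreserving
      (Fin.consLinearEquiv ℝ (fun _ : Fin (n + 1) => ℝ)).toLinearMap ?_
    convert! (volume_preserving_piFinSuccAbove (fun _ : Fin (n + 1) => ℝ) 0).symm _ using 1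
    ext x i
    simp [Fin.consLinearEquiv, MeasurableEquiv.piFinSuccAbove, Fin.insertNthEquiv]

lemma midpointPrekopaLeindler_euclideanSpace (n : ℕ) :
    MidpointPrekopaLeindler (volume : Measure (EuclideanSpace ℝ (Fin n))) :=
  (midpointPrekopaLeindler_pi n).of_measurePreserving
    (WithLp.linearEquiv 2 ℝ (Fin n → ℝ)).symm.toLinearMap
    (PiLp.volume_preserving_toLp _)

lemma MidpointPrekopaLeindler.smul_restrict {E : Type*} [AddCommGroup E] [Module ℝ E]
    [MeasurableSpace E] {μ : Measure E} (hμ : MidpointPrekopaLeindler μ) {K : Set E}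
    (hK : Convex ℝ K) (hKm : MeasurableSet K) (c : ℝ≥0∞) :
    MidpointPrekopaLeindler (c • μ.restrict K) := by
  intro f g h hf hg hh H
  simp only [lintegral_smul_measure, smul_eq_mul, ← lintegral_indicator hKm]
  have key := hμ _ _ _ (hf.indicator hKm) (hg.indicator hKm) (hh.indicator hKm) (by
    intro x y
    by_cases hx : x ∈ K
    · by_cases hy : y ∈ K
      · have : (2⁻¹ : ℝ) • (x + y) ∈ K := by
          rw [smul_add]
          exact hK hx hy (by norm_num) (by norm_num) (by norm_num)
        simpa only [Set.indicator_of_mem, hx, hy, this] using H x y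
      · simp [hy]
    · simp [hx])
  calc _ = c ^ 2 * ((∫⁻ x, K.indicator f x ∂μ) * ∫⁻ x, K.indicator g x ∂μ) := by ring
    _ ≤ c ^ 2 * (∫⁻ x, K.indicator h x ∂μ) ^ 2 := by gcongr
    _ = _ := by ring

/-- A function which behaves like the absolute value of an affine function. -/
def IsAbsAffineLike {E : Type*} [AddCommGroup E] [Module ℝ E] (φ : E → ℝ≥0∞) : Prop :=
  ∀ y z, φ y ≤ 2 * φ ((2⁻¹ : ℝ) • (y + z)) + φ z

lemma lintegral_pow_two_mul_le {E : Type*} [AddCommGroup E] [Module ℝ E]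
    [MeasurableSpace E] {μ : Measure E} [IsProbabilityMeasure μ]
    (hμ : MidpointPrekopaLeindler μ) {φ : E → ℝ≥0∞} (hφ : Measurable φ)
    (hφ' : IsAbsAffineLike φ) {r : ℕ} (hr : r ≠ 0) :
    ∫⁻ x, φ x ^ (2 * r) ∂μ ≤ 2 * (∫⁻ x, (2 * φ x + 2 * ∫⁻ y, φ y ∂μ) ^ r ∂μ) ^ 2 := by
  set m := ∫⁻ y, φ y ∂μ with hm
  rcases eq_or_ne m ⊤ with h | hmt
  · simp [h, hr]
  rcases eq_or_ne m 0 with h | hm0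
  · have h0 : φ =ᵐ[μ] 0 := (lintegral_eq_zero_iff hφ).1 h
    have : ∫⁻ x, φ x ^ (2 * r) ∂μ = 0 := by
      rw [lintegral_eq_zero_iff (hφ.pow_const _)]
      filter_upwards [h0] with x hx
      simp [hx, hr]
    simp [this]
  have hS : MeasurableSet {x | φ x ≤ 2 * m} := measurableSet_le hφ measurable_const
  have key := hμ (fun x => φ x ^ (2 * r)) ({x | φ x ≤ 2 * m}.indicator 1)
    (fun x => (2 * φ x + 2 * m) ^ r) (hφ.pow_const _) (measurable_one.indicator hS)
    (((hφ.const_mul 2).add_const _).pow_const _) (by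
      intro x y
      by_cases hy : φ y ≤ 2 * m
      · simp only [Set.indicator, Set.mem_ofPred_eq, hy, if_true, Pi.one_apply, mul_one]
        rw [← pow_mul, mul_comm 2 r]
        gcongr
        exact (hφ' x y).trans (by gcongr)
      · simp [Set.indicator, hy])
  rw [lintegral_indicator_one hS] at key
  have half : 1 ≤ 2 * μ {x | φ x ≤ 2 * m} := by
    have h1 : 2 * μ {x | φ x ≤ 2 * m}ᶜ ≤ 1 := by
      have h2 : (2 * m) * μ {x | 2 * m ≤ φ x} ≤ m := mul_meas_ge_le_lintegral hφ (2 * m)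
      have h3 : μ {x | φ x ≤ 2 * m}ᶜ ≤ μ {x | 2 * m ≤ φ x} :=
        measure_mono fun x hx => (not_le.1 (show ¬ φ x ≤ 2 * m from hx)).le
      rw [← ENNReal.mul_le_mul_iff_right hm0 hmt]
      calc m * (2 * μ {x | φ x ≤ 2 * m}ᶜ) ≤ m * (2 * μ {x | 2 * m ≤ φ x}) := by gcongr
        _ = (2 * m) * μ {x | 2 * m ≤ φ x} := by ring
        _ ≤ m * 1 := by simpa using h2
    have h4 : 2 * μ {x | φ x ≤ 2 * m} + 2 * μ {x | φ x ≤ 2 * m}ᶜ = 1 + 1 := by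
      rw [← mul_add, measure_add_measure_compl hS, measure_univ]; norm_num
    have h5 : 1 + 1 ≤ 2 * μ {x | φ x ≤ 2 * m} + 1 := by
      rw [← h4]; gcongr
    exact (ENNReal.add_le_add_iff_right ENNReal.one_ne_top).1 h5
  calc ∫⁻ x, φ x ^ (2 * r) ∂μ
      = (∫⁻ x, φ x ^ (2 * r) ∂μ) * 1 := by simp
    _ ≤ (∫⁻ x, φ x ^ (2 * r) ∂μ) * (2 * μ {x | φ x ≤ 2 * m}) := by gcongr
    _ = 2 * ((∫⁻ x, φ x ^ (2 * r) ∂μ) * μ {x | φ x ≤ 2 * m}) := by ring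
    _ ≤ _ := by gcongr

lemma ENNReal.add_pow_le_two_pow_mul (a b : ℝ≥0∞) (r : ℕ) :
    (a + b) ^ r ≤ 2 ^ r * (a ^ r + b ^ r) := by
  rcases le_total a b with h | h
  · calc (a + b) ^ r ≤ (2 * b) ^ r := by rw [two_mul]; gcongr
      _ = 2 ^ r * b ^ r := mul_pow _ _ _
      _ ≤ _ := by gcongr; exact le_add_self
  · calc (a + b) ^ r ≤ (2 * a) ^ r := by rw [two_mul]; gcongr
      _ = 2 ^ r * a ^ r := mul_pow _ _ _
      _ ≤ _ := by gcongr; exact le_self_add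

/-- The constant in the comparison of the `2 ^ k`-th moment with the first one. -/
def momentConst : ℕ → ℕ
  | 0 => 1
  | k + 1 => 2 * (4 ^ 2 ^ k * (momentConst k + 1)) ^ 2

lemma one_le_momentConst (k : ℕ) : 1 ≤ momentConst k := by
  cases k with
  | zero => exact le_rfl
  | succ k => exact Nat.succ_le_of_lt (by unfold momentConst; positivity)

lemma lintegral_pow_le_momentConst {E : Type*} [AddCommGroup E] [Module ℝ E]
    [MeasurableSpace E] {μ : Measure E} [IsProbabilityMeasure μ]
    (hμ : MidpointPrekopaLeindler μ) {φ : E → ℝ≥0∞} (hφ : Measurable φ)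
    (hφ' : IsAbsAffineLike φ) (k : ℕ) :
    ∫⁻ x, φ x ^ 2 ^ k ∂μ ≤ momentConst k * (∫⁻ x, φ x ∂μ) ^ 2 ^ k := by
  induction k with
  | zero => simp [momentConst]
  | succ k ih =>
    set m := ∫⁻ y, φ y ∂μ with hm
    have h1 := lintegral_pow_two_mul_le hμ hφ hφ' (r := 2 ^ k) (by positivity)
    have h2 : ∫⁻ x, (2 * φ x + 2 * m) ^ 2 ^ k ∂μ
        ≤ 4 ^ 2 ^ k * (momentConst k + 1) * m ^ 2 ^ k := by
      calc ∫⁻ x, (2 * φ x + 2 * m) ^ 2 ^ k ∂μ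
          ≤ ∫⁻ x, 4 ^ 2 ^ k * (φ x ^ 2 ^ k + m ^ 2 ^ k) ∂μ := by
            refine lintegral_mono fun x => ?_
            calc (2 * φ x + 2 * m) ^ 2 ^ k = 2 ^ 2 ^ k * (φ x + m) ^ 2 ^ k := by
                  rw [← mul_add, mul_pow]
              _ ≤ 2 ^ 2 ^ k * (2 ^ 2 ^ k * (φ x ^ 2 ^ k + m ^ 2 ^ k)) := by
                  gcongr; exact ENNReal.add_pow_le_two_pow_mul _ _ _
              _ = _ := by rw [← mul_assoc, ← mul_pow]; norm_num
        _ = 4 ^ 2 ^ k * ((∫⁻ x, φ x ^ 2 ^ k ∂μ) + m ^ 2 ^ k) := by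
            rw [lintegral_const_mul _ ((hφ.pow_const _).add_const _),
              lintegral_add_right _ measurable_const]
            simp
        _ ≤ 4 ^ 2 ^ k * (momentConst k * m ^ 2 ^ k + m ^ 2 ^ k) := by gcongr
        _ = _ := by ring
    rw [pow_succ' 2 k]
    calc _ ≤ _ := h1
      _ ≤ 2 * (4 ^ 2 ^ k * (momentConst k + 1) * m ^ 2 ^ k) ^ 2 := by gcongr
      _ = _ := by
        simp only [momentConst]
        push_cast
        ring

lemma measurePreserving_finCons {E : Type*} [MeasurableSpace E] (μ : Measure E) [SigmaFinite μ]
    (N : ℕ) : MeasurePreserving (fun z : E × (Fin N → E) => (Fin.cons z.1 z.2 : Fin (N + 1) → E))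
      (μ.prod (Measure.pi fun _ => μ)) (Measure.pi fun _ => μ) := by
  convert! (measurePreserving_piFinSuccAbove (fun _ : Fin (N + 1) => μ) 0).symm _ using 1
  ext x i
  simp [MeasurableEquiv.piFinSuccAbove, Fin.insertNthEquiv]

lemma lintegral_pi_pow_le {E : Type*} [AddCommGroup E] [Module ℝ E]
    [MeasurableSpace E] {μ : Measure E} [IsProbabilityMeasure μ] {C : ℝ≥0∞} {q : ℕ}
    (H : ∀ φ : E → ℝ≥0∞, Measurable φ → IsAbsAffineLike φ →
      ∫⁻ x, φ x ^ q ∂μ ≤ C * (∫⁻ x, φ x ∂μ) ^ q)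
    (N : ℕ) (Φ : (Fin N → E) → ℝ≥0∞) (hΦ : Measurable Φ)
    (hΦ' : ∀ x i, IsAbsAffineLike fun y => Φ (Function.update x i y)) :
    ∫⁻ x, Φ x ^ q ∂(Measure.pi fun _ => μ)
      ≤ C ^ N * (∫⁻ x, Φ x ∂(Measure.pi fun _ => μ)) ^ q := by
  induction N with
  | zero =>
    simp [lintegral_unique]
  | succ N ih =>
    have mp := measurePreserving_finCons μ N
    have cons : ∀ Ψ : (Fin (N + 1) → E) → ℝ≥0∞, Measurable Ψ →
        ∫⁻ x, Ψ x ∂(Measure.pi fun _ => μ)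
          = ∫⁻ x, ∫⁻ y, Ψ (Fin.cons y x : Fin (N + 1) → E) ∂μ ∂(Measure.pi fun _ => μ) := by
      intro Ψ hΨ
      rw [← mp.lintegral_comp hΨ, lintegral_prod_symm
        (fun z : E × (Fin N → E) => Ψ (Fin.cons z.1 z.2)) (hΨ.comp mp.measurable).aemeasurable]
    have consm : Measurable fun z : E × (Fin N → E) => (Fin.cons z.1 z.2 : Fin (N + 1) → E) :=
      mp.measurable
    rw [cons _ (hΦ.pow_const _), cons _ hΦ]
    calc ∫⁻ x, ∫⁻ y, Φ (Fin.cons y x : Fin (N + 1) → E) ^ q ∂μ ∂(Measure.pi fun _ => μ)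
        ≤ ∫⁻ x, C * (∫⁻ y, Φ (Fin.cons y x : Fin (N + 1) → E) ∂μ) ^ q
            ∂(Measure.pi fun _ => μ) := by
          refine lintegral_mono fun x => ?_
          refine H _ (hΦ.comp (consm.comp measurable_prodMk_right)) ?_
          intro y z
          have := hΦ' (Fin.cons 0 x : Fin (N + 1) → E) 0 y z
          simpa only [Fin.update_cons_zero] using this
      _ = C * ∫⁻ x, (∫⁻ y, Φ (Fin.cons y x : Fin (N + 1) → E) ∂μ) ^ q
            ∂(Measure.pi fun _ => μ) := by
          rw [lintegral_const_mul]
          exact ((hΦ.comp consm).lintegral_prod_left').pow_const q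
      _ ≤ C * (C ^ N * (∫⁻ x, ∫⁻ y, Φ (Fin.cons y x : Fin (N + 1) → E) ∂μ
            ∂(Measure.pi fun _ => μ)) ^ q) := by
          gcongr
          refine ih _ ((hΦ.comp consm).lintegral_prod_left') ?_
          intro x i y z
          have m1 : ∀ x : Fin N → E, Measurable fun w => Φ (Fin.cons w x : Fin (N + 1) → E) :=
            fun x => hΦ.comp (consm.comp measurable_prodMk_right)
          calc _ ≤ ∫⁻ w, (2 * Φ (Fin.cons w (Function.update x i ((2⁻¹ : ℝ) • (y + z))) :
                      Fin (N + 1) → E)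
                    + Φ (Fin.cons w (Function.update x i z) : Fin (N + 1) → E)) ∂μ := by
                refine lintegral_mono fun w => ?_
                have := hΦ' (Fin.cons w x : Fin (N + 1) → E) i.succ y z
                simpa only [Fin.cons_update] using this
            _ = _ := by
                rw [lintegral_add_right _ (m1 _), lintegral_const_mul _ (m1 _)]
      _ = _ := by ring

lemma moment_comparison {Ω : Type*} [MeasurableSpace Ω] {ν : Measure Ω} [IsProbabilityMeasure ν]
    {f : Ω → ℝ} (hf : Measurable f) (hf₁ : ∀ᵐ x ∂ν, |f x| ≤ 1)
    {C p q : ℝ} {Q n N : ℕ} (hC : 1 ≤ C) (hn : 0 < n) (hN : N ≤ 2 * n) (hp : 1 ≤ p) (hpq : p < q)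
    (hqQ : q ≤ Q)
    (H : ∫⁻ x, ‖f x‖ₑ ^ Q ∂ν ≤ ENNReal.ofReal C ^ N * (∫⁻ x, ‖f x‖ₑ ∂ν) ^ Q) :
    ((∫ x, |f x| ^ p ∂ν) ^ (1 / p)) ^ ((n : ℝ)⁻¹) ≤
        ((∫ x, |f x| ^ q ∂ν) ^ (1 / q)) ^ ((n : ℝ)⁻¹) ∧
      ((∫ x, |f x| ^ q ∂ν) ^ (1 / q)) ^ ((n : ℝ)⁻¹) ≤
        C ^ 2 * ((∫ x, |f x| ^ p ∂ν) ^ (1 / p)) ^ ((n : ℝ)⁻¹) := by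
  have hQ : 1 ≤ (Q : ℝ) := by linarith
  have hnorm : ∀ r : ℝ, 0 < r → (∫ x, |f x| ^ r ∂ν) ^ (1 / r) = (eLpNorm' f r ν).toReal := by
    intro r hr
    rw [integral_eq_lintegral_of_nonneg_ae (by filter_upwards with x using by positivity)
      (hf.abs.pow_const r).aestronglyMeasurable, eLpNorm'_eq_lintegral_enorm, ENNReal.toReal_rpow]
    congr 3 with x
    rw [Real.enorm_eq_ofReal_abs, ENNReal.ofReal_rpow_of_nonneg (abs_nonneg _) hr.le]
  have hfin : ∀ r : ℝ, 0 < r → eLpNorm' f r ν ≠ ⊤ := by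
    intro r hr
    rw [eLpNorm'_eq_lintegral_enorm]
    refine ENNReal.rpow_ne_top_of_nonneg (by positivity) (ne_top_of_le_ne_top
      ENNReal.one_ne_top ?_)
    calc ∫⁻ x, ‖f x‖ₑ ^ r ∂ν ≤ ∫⁻ x, 1 ∂ν := by
          refine lintegral_mono_ae ?_
          filter_upwards [hf₁] with x hx
          refine ENNReal.rpow_le_one ?_ hr.le
          rw [Real.enorm_eq_ofReal_abs]
          simpa using hx
      _ = 1 := by simp
  have mono : ∀ r s : ℝ, 0 < r → r ≤ s → eLpNorm' f r ν ≤ eLpNorm' f s ν := fun r s hr hrs =>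
    eLpNorm'_le_eLpNorm'_of_exponent_le hr hrs ν hf.aestronglyMeasurable
  rw [hnorm p (by linarith), hnorm q (by linarith)]
  refine ⟨?_, ?_⟩
  · gcongr
    · exact hfin q (by linarith)
    · exact mono p q (by linarith) hpq.le
  have step : eLpNorm' f Q ν ≤ ENNReal.ofReal C ^ (2 * n) * eLpNorm' f 1 ν := by
    rw [eLpNorm'_eq_lintegral_enorm, eLpNorm'_eq_lintegral_enorm]
    simp only [ENNReal.rpow_natCast, ENNReal.rpow_one, div_one]
    have hC' : 1 ≤ ENNReal.ofReal C ^ (2 * n) := one_le_pow₀ (by simpa using hC)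
    rw [one_div, ENNReal.rpow_inv_le_iff (by linarith), ENNReal.rpow_natCast, mul_pow]
    refine H.trans ?_
    refine mul_le_mul' ?_ le_rfl
    refine (pow_le_pow_right₀ (by simpa using hC) hN).trans ?_
    exact le_self_pow₀ hC' (by rintro rfl; norm_num at hQ)
  have step2 : (eLpNorm' f q ν).toReal ≤ C ^ (2 * n) * (eLpNorm' f p ν).toReal := by
    have : eLpNorm' f q ν ≤ ENNReal.ofReal C ^ (2 * n) * eLpNorm' f p ν :=
      (mono q Q (by linarith) hqQ).trans (step.trans (by
        gcongr; exact mono 1 p one_pos hp))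
    have h := ENNReal.toReal_mono (ENNReal.mul_ne_top (by simp) (hfin p (by linarith))) this
    rwa [ENNReal.toReal_mul, ENNReal.toReal_pow, ENNReal.toReal_ofReal (by linarith)] at h
  calc (eLpNorm' f q ν).toReal ^ ((n : ℝ)⁻¹)
      ≤ ((C ^ 2) ^ n * (eLpNorm' f p ν).toReal) ^ ((n : ℝ)⁻¹) := by
        rw [← pow_mul]; gcongr
    _ = _ := by
        rw [Real.mul_rpow (by positivity) (by positivity),
          Real.pow_rpow_inv_natCast (by positivity) hn.ne']

lemma volume_image_constr {n : ℕ} (b : Module.Basis (Fin n) ℝ (EuclideanSpace ℝ (Fin n)))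
    (x : Fin n → EuclideanSpace ℝ (Fin n)) (S : Set (EuclideanSpace ℝ (Fin n))) :
    volume (b.constr ℕ x '' S) = ENNReal.ofReal |b.det x| * volume S := by
  rw [Measure.addHaar_image_linearMap, ← LinearMap.det_toMatrix b,
    ← Module.Basis.toMatrix_eq_toMatrix_constr, ← Module.Basis.det_apply]

lemma exists_randCrossVol_eq (n : ℕ) (K : Set (EuclideanSpace ℝ (Fin n)))
    (b : Module.Basis (Fin n) ℝ (EuclideanSpace ℝ (Fin n))) :
    ∃ c : ℝ, ∀ x, randCrossVol n K x = |b.det x| * c := by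
  refine ⟨(volume (convexHull ℝ (Set.range b ∪ -Set.range b))).toReal / (volume K).toReal,
    fun x => ?_⟩
  have : Set.range x ∪ -Set.range x = b.constr ℕ x '' (Set.range b ∪ -Set.range b) := by
    rw [Set.image_union, Set.image_neg_of_apply_neg_eq_neg fun y _ => map_neg _ y]
    have : b.constr ℕ x '' Set.range b = Set.range x := by
      rw [← Set.range_comp]
      congr 1
      ext1 i
      simp
    rw [this]
  rw [randCrossVol, this, ← LinearMap.image_convexHull, volume_image_constr, ENNReal.toReal_mul,
    ENNReal.toReal_ofReal (abs_nonneg _), mul_div_assoc]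

lemma exists_randSimplexVol_eq (n : ℕ) (K : Set (EuclideanSpace ℝ (Fin n)))
    (b : Module.Basis (Fin n) ℝ (EuclideanSpace ℝ (Fin n))) :
    ∃ c : ℝ, ∀ x, randSimplexVol n K x = |b.det fun i => x i.succ - x 0| * c := by
  refine ⟨(volume (convexHull ℝ (Set.range (Fin.cons 0 b : Fin (n + 1) → _)))).toReal
    / (volume K).toReal, fun x => ?_⟩
  have : Set.range x = x 0 +ᵥ (b.constr ℕ (fun i => x i.succ - x 0) ''
      Set.range (Fin.cons 0 b : Fin (n + 1) → EuclideanSpace ℝ (Fin n))) := by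
    rw [← Set.range_comp, Set.vadd_set_range]
    congr 1
    ext1 i
    refine Fin.cases ?_ (fun j => ?_) i <;> simp
  rw [randSimplexVol, this, convexHull_vadd, measure_vadd, ← LinearMap.image_convexHull,
    volume_image_constr, ENNReal.toReal_mul, ENNReal.toReal_ofReal (abs_nonneg _), mul_div_assoc]

lemma isAbsAffineLike_enorm {E : Type*} [AddCommGroup E] [Module ℝ E] {f D : E → ℝ} {c : ℝ}
    (hf : ∀ y, f y = |D y| * c)
    (hD : ∀ y z, D ((2⁻¹ : ℝ) • (y + z)) = 2⁻¹ * (D y + D z)) :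
    IsAbsAffineLike fun y => ‖f y‖ₑ := by
  intro y z
  have key : |f y| ≤ 2 * |f ((2⁻¹ : ℝ) • (y + z))| + |f z| := by
    simp only [hf, abs_mul, abs_abs]
    have h : |D y| ≤ 2 * |D ((2⁻¹ : ℝ) • (y + z))| + |D z| := by
      calc |D y| = |2 * D ((2⁻¹ : ℝ) • (y + z)) - D z| := by rw [hD]; congr 1; ring
        _ ≤ |2 * D ((2⁻¹ : ℝ) • (y + z))| + |D z| := abs_sub _ _
        _ = _ := by rw [abs_mul, abs_two]
    nlinarith [mul_le_mul_of_nonneg_right h (abs_nonneg c)]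
  simp only [Real.enorm_eq_ofReal_abs]
  rw [show (2 : ℝ≥0∞) = ENNReal.ofReal 2 by simp, ← ENNReal.ofReal_mul (by norm_num),
    ← ENNReal.ofReal_add (by positivity) (by positivity)]
  exact ENNReal.ofReal_le_ofReal key

lemma det_update_midpoint {n : ℕ} (b : Module.Basis (Fin n) ℝ (EuclideanSpace ℝ (Fin n)))
    (v : Fin n → EuclideanSpace ℝ (Fin n)) (i : Fin n) (y z : EuclideanSpace ℝ (Fin n)) :
    b.det (Function.update v i ((2⁻¹ : ℝ) • (y + z)))
      = 2⁻¹ * (b.det (Function.update v i y) + b.det (Function.update v i z)) := by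
  rw [AlternatingMap.map_update_smul, AlternatingMap.map_update_add, smul_eq_mul]

lemma measurable_basis_det {n : ℕ} (b : Module.Basis (Fin n) ℝ (EuclideanSpace ℝ (Fin n))) :
    Measurable fun x : Fin n → EuclideanSpace ℝ (Fin n) => b.det x := by
  refine Continuous.measurable ?_
  simp only [Module.Basis.det_apply]
  refine Continuous.matrix_det ?_
  refine continuous_matrix fun i j => ?_
  simp only [Module.Basis.toMatrix_apply]
  exact (LinearMap.continuous_of_finiteDimensional (b.coord i)).comp (continuous_apply j)

lemma isAbsAffineLike_randCrossVol (n : ℕ) (K : Set (EuclideanSpace ℝ (Fin n)))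
    (x : Fin n → EuclideanSpace ℝ (Fin n)) (i : Fin n) :
    IsAbsAffineLike fun y => ‖randCrossVol n K (Function.update x i y)‖ₑ := by
  obtain ⟨c, hc⟩ := exists_randCrossVol_eq n K (EuclideanSpace.basisFun (Fin n) ℝ).toBasis
  exact isAbsAffineLike_enorm (fun y => hc _) (det_update_midpoint _ x i)

lemma isAbsAffineLike_randSimplexVol_succ (n : ℕ) (K : Set (EuclideanSpace ℝ (Fin n)))
    (x : Fin (n + 1) → EuclideanSpace ℝ (Fin n)) (i : Fin n) :
    IsAbsAffineLike fun y => ‖randSimplexVol n K (Function.update x i.succ y)‖ₑ := by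
  set b := (EuclideanSpace.basisFun (Fin n) ℝ).toBasis
  obtain ⟨c, hc⟩ := exists_randSimplexVol_eq n K b
  refine isAbsAffineLike_enorm (c := c)
    (D := fun y => b.det (Function.update (fun j : Fin n => x j.succ - x 0) i (y - x 0)))
    (fun y => ?_) fun y z => ?_
  · rw [hc]
    congr 3
    ext1 j
    have h0 : Function.update x i.succ y 0 = x 0 :=
      Function.update_of_ne (Fin.succ_ne_zero i).symm y x
    rw [h0]
    rcases eq_or_ne j i with rfl | h
    · simp
    · simp [h]
  · rw [← det_update_midpoint]
    congr 2
    module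

lemma isAbsAffineLike_randSimplexVol {n : ℕ} (hn : 0 < n) (K : Set (EuclideanSpace ℝ (Fin n)))
    (x : Fin (n + 1) → EuclideanSpace ℝ (Fin n)) (i : Fin (n + 1)) :
    IsAbsAffineLike fun y => ‖randSimplexVol n K (Function.update x i y)‖ₑ := by
  refine Fin.cases ?_ (fun j => isAbsAffineLike_randSimplexVol_succ n K x j) i
  let j : Fin n := ⟨0, hn⟩
  let σ : Fin (n + 1) ≃ Fin (n + 1) := Equiv.swap 0 j.succ
  have hσ : ∀ v, randSimplexVol n K (v ∘ σ) = randSimplexVol n K v := by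
    intro v
    rw [randSimplexVol, randSimplexVol, σ.surjective.range_comp]
  have := isAbsAffineLike_randSimplexVol_succ n K (x ∘ σ) j
  convert this using 3 with y
  rw [← hσ, Function.update_comp_equiv]
  simp [σ]

lemma measurable_randCrossVol (n : ℕ) (K : Set (EuclideanSpace ℝ (Fin n))) :
    Measurable (randCrossVol n K) := by
  obtain ⟨c, hc⟩ := exists_randCrossVol_eq n K (EuclideanSpace.basisFun (Fin n) ℝ).toBasis
  rw [funext hc]
  exact (measurable_basis_det _).abs.mul_const c

lemma measurable_randSimplexVol (n : ℕ) (K : Set (EuclideanSpace ℝ (Fin n))) :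
    Measurable (randSimplexVol n K) := by
  obtain ⟨c, hc⟩ := exists_randSimplexVol_eq n K (EuclideanSpace.basisFun (Fin n) ℝ).toBasis
  rw [funext hc]
  exact ((measurable_basis_det _).comp (by fun_prop)).abs.mul_const c

lemma isProbabilityMeasure_unifMeasure {n : ℕ} {K : Set (EuclideanSpace ℝ (Fin n))}
    (hKc : IsCompact K) (hKi : (interior K).Nonempty) :
    IsProbabilityMeasure (unifMeasure n K) := by
  refine ⟨?_⟩
  rw [unifMeasure, Measure.smul_apply, Measure.restrict_apply_univ, smul_eq_mul]
  refine ENNReal.inv_mul_cancel ?_ hKc.measure_lt_top.ne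
  exact (Measure.measure_pos_of_nonempty_interior volume hKi).ne'

lemma ae_jointUnif_mem {n N : ℕ} {K : Set (EuclideanSpace ℝ (Fin n))}
    (hKc : IsCompact K) (hKi : (interior K).Nonempty) :
    ∀ᵐ x ∂jointUnif n N K, ∀ i, x i ∈ K := by
  have := isProbabilityMeasure_unifMeasure hKc hKi
  rw [MeasureTheory.ae_all_iff]
  intro i
  have h : ∀ᵐ y ∂unifMeasure n K, y ∈ K :=
    Measure.ae_smul_measure (ae_restrict_mem hKc.measurableSet) _
  exact (Measure.tendsto_eval_ae_ae (μ := fun _ : Fin N => unifMeasure n K) (i := i)).eventually h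

lemma abs_toReal_volume_div_le_one {n : ℕ} {K S : Set (EuclideanSpace ℝ (Fin n))}
    (hK : Convex ℝ K) (hKc : IsCompact K) (hS : S ⊆ K) :
    |(volume (convexHull ℝ S)).toReal / (volume K).toReal| ≤ 1 := by
  rw [abs_of_nonneg (by positivity)]
  refine div_le_one_of_le₀ ?_ ENNReal.toReal_nonneg
  exact ENNReal.toReal_mono hKc.measure_lt_top.ne (measure_mono (convexHull_min hS hK))

lemma jointUnif_moment_comparison {n N k : ℕ} {K : Set (EuclideanSpace ℝ (Fin n))}
    (hK : Convex ℝ K) (hKc : IsCompact K) (hKi : (interior K).Nonempty)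
    {f : (Fin N → EuclideanSpace ℝ (Fin n)) → ℝ} (hf : Measurable f)
    (hf₁ : ∀ x, (∀ i, x i ∈ K) → |f x| ≤ 1)
    (hf' : ∀ x i, IsAbsAffineLike fun y => ‖f (Function.update x i y)‖ₑ)
    {p q : ℝ} (hn : 0 < n) (hN : N ≤ 2 * n) (hp : 1 ≤ p) (hpq : p < q) (hk : q ≤ 2 ^ k) :
    ((∫ x, |f x| ^ p ∂jointUnif n N K) ^ (1 / p)) ^ ((n : ℝ)⁻¹) ≤
        ((∫ x, |f x| ^ q ∂jointUnif n N K) ^ (1 / q)) ^ ((n : ℝ)⁻¹) ∧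
      ((∫ x, |f x| ^ q ∂jointUnif n N K) ^ (1 / q)) ^ ((n : ℝ)⁻¹) ≤
        (momentConst k : ℝ) ^ 2 *
          ((∫ x, |f x| ^ p ∂jointUnif n N K) ^ (1 / p)) ^ ((n : ℝ)⁻¹) := by
  have := isProbabilityMeasure_unifMeasure hKc hKi
  have : IsProbabilityMeasure (jointUnif n N K) := by unfold jointUnif; infer_instance
  have hμ : MidpointPrekopaLeindler (unifMeasure n K) :=
    (midpointPrekopaLeindler_euclideanSpace n).smul_restrict hK hKc.measurableSet _
  refine moment_comparison (Q := 2 ^ k) hf ((ae_jointUnif_mem hKc hKi).mono hf₁)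
    (by exact_mod_cast one_le_momentConst k) hn hN hp hpq (by exact_mod_cast hk) ?_
  rw [ENNReal.ofReal_natCast]
  exact lintegral_pi_pow_le (fun φ hφ hφ' => lintegral_pow_le_momentConst hμ hφ hφ' k) N _
    hf.enorm hf'

/-- For `1 ≤ p < q < ∞` there is a constant `c_{p,q} > 0` such that, uniformly over all
dimensions `n`, `‖V_K‖_p^{1/n} ≤ ‖V_K‖_q^{1/n} ≤ c_{p,q} ‖V_K‖_p^{1/n}` for every symmetric
convex body `K ⊆ ℝⁿ`, and `‖U_K‖_p^{1/n} ≤ ‖U_K‖_q^{1/n} ≤ c_{p,q} ‖U_K‖_p^{1/n}` for every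
convex body `K ⊆ ℝⁿ`. -/
theorem lpNorm_nthRoot_equivalence
    (p q : ℝ) (hp : 1 ≤ p) (hpq : p < q) :
    ∃ c : ℝ, 0 < c ∧
      ∀ n : ℕ, 0 < n →
        (∀ K : Set (EuclideanSpace ℝ (Fin n)),
          Convex ℝ K → IsCompact K → (interior K).Nonempty → K = -K →
            lpNormV n K p ^ ((n : ℝ)⁻¹) ≤ lpNormV n K q ^ ((n : ℝ)⁻¹) ∧
            lpNormV n K q ^ ((n : ℝ)⁻¹) ≤ c * lpNormV n K p ^ ((n : ℝ)⁻¹)) ∧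
        (∀ K : Set (EuclideanSpace ℝ (Fin n)),
          Convex ℝ K → IsCompact K → (interior K).Nonempty →
            lpNormU n K p ^ ((n : ℝ)⁻¹) ≤ lpNormU n K q ^ ((n : ℝ)⁻¹) ∧
            lpNormU n K q ^ ((n : ℝ)⁻¹) ≤ c * lpNormU n K p ^ ((n : ℝ)⁻¹)) := by
  obtain ⟨k, hk⟩ := pow_unbounded_of_one_lt q one_lt_two
  refine ⟨(momentConst k : ℝ) ^ 2, ?_, fun n hn => ⟨?_, ?_⟩⟩
  · have : 0 < momentConst k := one_le_momentConst k
    positivity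
  · intro K hK hKc hKi hKs
    refine jointUnif_moment_comparison hK hKc hKi (measurable_randCrossVol n K) (fun x hx => ?_)
      (isAbsAffineLike_randCrossVol n K) hn (by lia) hp hpq hk.le
    refine abs_toReal_volume_div_le_one hK hKc ?_
    have hsub : Set.range x ⊆ K := Set.range_subset_iff.2 hx
    refine Set.union_subset hsub ?_
    rw [hKs]
    exact Set.neg_subset_neg.2 hsub
  · intro K hK hKc hKi
    refine jointUnif_moment_comparison hK hKc hKi (measurable_randSimplexVol n K) (fun x hx => ?_)
      (isAbsAffineLike_randSimplexVol hn K) hn (by lia) hp hpq hk.le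
    exact abs_toReal_volume_div_le_one hK hKc (Set.range_subset_iff.2 hx)
end

section
/- Let K be a symmetric convex body in ℝⁿ. Then E V_K² = (4ⁿ / n!) · det M / |K|^{n+2}, where M is the n × n matrix with entries M_{ij} = ∫_K x_i x_j dx. Equivalently, (E V_K²)^{1/n} = (4 / (n!)^{1/n}) L_K², where L_K is the isotropic constant of K defined by L_K^{2n} = det[ (1/|K|^{(n+2)/n}) ∫_K x_i x_j dx ]. -/
open MeasureTheory Pointwise

/-- The matrix of second moments (inertia matrix) of `K`: `M i j = ∫_K x_i x_j dx`. -/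
noncomputable def inertiaMatrix (n : ℕ) (K : Set (EuclideanSpace ℝ (Fin n))) :
    Matrix (Fin n) (Fin n) ℝ :=
  Matrix.of fun i j => ∫ x in K, x i * x j

/-- The symmetric convex hull of finitely many points is the image of the cross-polytope under
the linear combination map. -/
theorem convexHull_range_union_neg {ι E : Type*} [Fintype ι] [Nonempty ι] [AddCommGroup E]
    [Module ℝ E] (x : ι → E) :
    convexHull ℝ (Set.range x ∪ -Set.range x) =
      (fun c : ι → ℝ => ∑ i, c i • x i) '' {c | ∑ i, |c i| ≤ 1} := by
  classical
  apply Set.Subset.antisymm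
  · apply convexHull_min
    · rintro y (⟨i, rfl⟩ | hy)
      · refine ⟨Pi.single i 1, ?_, ?_⟩
        · simp [Pi.single_apply, apply_ite abs]
        · simp [Pi.single_apply, ite_smul]
      · obtain ⟨i, hi⟩ := Set.mem_neg.mp hy
        refine ⟨Pi.single i (-1), ?_, ?_⟩
        · simp [Pi.single_apply, apply_ite abs]
        · simp [Pi.single_apply, ite_smul, hi]
    · rintro _ ⟨c, hc, rfl⟩ _ ⟨d, hd, rfl⟩ a b ha hb hab
      refine ⟨a • c + b • d, ?_, ?_⟩
      · calc ∑ i, |(a • c + b • d) i| ≤ ∑ i, (a * |c i| + b * |d i|) := by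
              refine Finset.sum_le_sum fun i _ => (abs_add_le _ _).trans_eq ?_
              simp [abs_mul, abs_of_nonneg ha, abs_of_nonneg hb]
          _ = a * ∑ i, |c i| + b * ∑ i, |d i| := by
              rw [Finset.sum_add_distrib, Finset.mul_sum, Finset.mul_sum]
          _ ≤ a * 1 + b * 1 := by gcongr <;> assumption
          _ = 1 := by linarith
      · simp [add_smul, mul_smul, Finset.sum_add_distrib, Finset.smul_sum]
  · rintro _ ⟨c, hc, rfl⟩
    have hN : (0 : ℝ) < Fintype.card ι := by exact_mod_cast Fintype.card_pos
    set r : ℝ := (1 - ∑ i, |c i|) / (2 * Fintype.card ι) with hr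
    have hr0 : 0 ≤ r := div_nonneg (sub_nonneg.mpr hc) (by positivity)
    have key := (convex_convexHull ℝ (Set.range x ∪ -Set.range x)).sum_mem
      (t := Finset.univ)
      (w := Sum.elim (fun i => (|c i| + c i) / 2 + r) (fun i => (|c i| - c i) / 2 + r))
      (z := Sum.elim x (fun i => -x i)) ?_ ?_ ?_
    · convert key using 1
      rw [Fintype.sum_sum_type, ← Finset.sum_add_distrib]
      refine Finset.sum_congr rfl fun i _ => ?_
      simp only [Sum.elim_inl, Sum.elim_inr]
      module
    · rintro (i | i) -
      · have := neg_abs_le (c i)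
        simp only [Sum.elim_inl]
        linarith
      · have := le_abs_self (c i)
        simp only [Sum.elim_inr]
        linarith
    · rw [Fintype.sum_sum_type, ← Finset.sum_add_distrib]
      simp only [Sum.elim_inl, Sum.elim_inr]
      have h : ∀ i, (|c i| + c i) / 2 + r + ((|c i| - c i) / 2 + r) = |c i| + 2 * r :=
        fun i => by ring
      simp only [h, Finset.sum_add_distrib, Finset.sum_const, Finset.card_univ, nsmul_eq_mul]
      rw [hr]
      field_simp
      ring
    · rintro (i | i) -
      · exact subset_convexHull ℝ _ (Or.inl ⟨i, rfl⟩)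
      · exact subset_convexHull ℝ _ (Or.inr (by simp))

/-- The volume of the cross-polytope. -/
theorem volume_sum_abs_le_one (ι : Type*) [Fintype ι] [Nonempty ι] :
    volume {c : ι → ℝ | ∑ i, |c i| ≤ 1} =
      ENNReal.ofReal (2 ^ Fintype.card ι / (Fintype.card ι).factorial) := by
  have h := volume_sum_rpow_le ι (p := 1) le_rfl 1
  have h1 : Real.Gamma (1 + 1) = 1 := by rw [one_add_one_eq_two, Real.Gamma_two]
  simpa [Real.Gamma_nat_eq_factorial, h1] using h

/-- The volume of the symmetric convex hull of `n` points of `ℝⁿ`. -/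
theorem volume_convexHull_range_union_neg {n : ℕ} (hn : 0 < n)
    (x : Fin n → EuclideanSpace ℝ (Fin n)) :
    volume (convexHull ℝ (Set.range x ∪ -Set.range x)) =
      ENNReal.ofReal (2 ^ n / n.factorial * |(Matrix.of fun i j => x i j).det|) := by
  have : Nonempty (Fin n) := ⟨⟨0, hn⟩⟩
  let b := (EuclideanSpace.basisFun (Fin n) ℝ).toBasis
  let A : Matrix (Fin n) (Fin n) ℝ := Matrix.of fun i j => x i j
  let L := Matrix.toLin b b A.transpose
  have hL : ∀ c : EuclideanSpace ℝ (Fin n), L c = ∑ i, c i • x i := by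
    intro c
    ext k
    simp [L, b, A, Matrix.toLin_apply, Matrix.mulVec, dotProduct, mul_comm,
      Pi.single_apply]
  have himage : convexHull ℝ (Set.range x ∪ -Set.range x) =
      L '' ((MeasurableEquiv.toLp 2 (Fin n → ℝ)).symm ⁻¹' {c | ∑ i, |c i| ≤ 1}) := by
    rw [convexHull_range_union_neg]
    ext y
    constructor
    · rintro ⟨c, hc, rfl⟩
      exact ⟨WithLp.toLp 2 c, hc, hL _⟩
    · rintro ⟨c, hc, rfl⟩
      exact ⟨WithLp.ofLp c, hc, (hL c).symm⟩
  have hdet : LinearMap.det L = A.det := by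
    simp only [L, LinearMap.det_toLin, Matrix.det_transpose]
  rw [himage, Measure.addHaar_image_linearMap,
    (EuclideanSpace.volume_preserving_symm_measurableEquiv_toLp (Fin n)).measure_preimage_equiv,
    volume_sum_abs_le_one, hdet, ← ENNReal.ofReal_mul (abs_nonneg _), Fintype.card_fin, mul_comm]

/-- The second moment of the determinant of a matrix with independent identically distributed
rows is `n!` times the determinant of the second-moment matrix of a row. -/
theorem integral_det_sq_pi {ι E : Type*} [Fintype ι] [DecidableEq ι] [MeasurableSpace E]
    (μ : Measure E) [SigmaFinite μ] (f : ι → E → ℝ)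
    (hf : ∀ j k, Integrable (fun y => f j y * f k y) μ) :
    ∫ x, (Matrix.of fun i j => f j (x i)).det ^ 2 ∂(Measure.pi fun _ : ι => μ) =
      (Fintype.card ι).factorial * (Matrix.of fun j k => ∫ y, f j y * f k y ∂μ).det := by
  set m : Matrix ι ι ℝ := Matrix.of fun j k => ∫ y, f j y * f k y ∂μ with hm
  have hexp : ∀ x : ι → E, (Matrix.of fun i j => f j (x i)).det ^ 2 =
      ∑ σ : Equiv.Perm ι, ∑ τ : Equiv.Perm ι,
        (((σ.sign : ℤ) : ℝ) * ((τ.sign : ℤ) : ℝ)) * ∏ i, (f (σ i) (x i) * f (τ i) (x i)) := by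
    intro x
    rw [← Matrix.det_transpose, Matrix.det_apply', sq, Finset.sum_mul_sum]
    refine Finset.sum_congr rfl fun σ _ => Finset.sum_congr rfl fun τ _ => ?_
    simp only [Matrix.transpose_apply, Matrix.of_apply, Finset.prod_mul_distrib]
    ring
  have hint : ∀ σ τ : Equiv.Perm ι, Integrable (fun x : ι → E =>
      (((σ.sign : ℤ) : ℝ) * ((τ.sign : ℤ) : ℝ)) * ∏ i, (f (σ i) (x i) * f (τ i) (x i)))
      (Measure.pi fun _ : ι => μ) := fun σ τ =>
    (Integrable.fintype_prod (f := fun i y => f (σ i) y * f (τ i) y)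
      fun i => hf (σ i) (τ i)).const_mul _
  have hσ : ∀ σ : Equiv.Perm ι, ∑ τ : Equiv.Perm ι,
      (((σ.sign : ℤ) : ℝ) * ((τ.sign : ℤ) : ℝ)) * ∏ i, m (σ i) (τ i) = m.det := by
    intro σ
    have h := Matrix.det_permute σ m
    rw [← Matrix.det_transpose, Matrix.det_apply'] at h
    simp only [mul_assoc, ← Finset.mul_sum]
    simp only [Matrix.transpose_apply, Matrix.submatrix_apply, id_eq] at h
    rw [h, ← mul_assoc]
    norm_cast
    simp
  simp_rw [hexp]
  rw [integral_finsetSum _ fun σ _ => integrable_finsetSum _ fun τ _ => hint σ τ]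
  have hterm : ∀ σ : Equiv.Perm ι, ∫ x : ι → E, ∑ τ : Equiv.Perm ι,
      (((σ.sign : ℤ) : ℝ) * ((τ.sign : ℤ) : ℝ)) * ∏ i, (f (σ i) (x i) * f (τ i) (x i))
      ∂(Measure.pi fun _ : ι => μ) = m.det := by
    intro σ
    rw [integral_finsetSum _ fun τ _ => hint σ τ, ← hσ σ]
    refine Finset.sum_congr rfl fun τ _ => ?_
    rw [integral_const_mul,
      integral_fintype_prod_eq_prod (f := fun i y => f (σ i) y * f (τ i) y)]
    rfl
  simp [hterm, Fintype.card_perm]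

/-- For a symmetric convex body `K ⊆ ℝⁿ`,
`𝔼 V_K² = (4ⁿ / n!) · det [∫_K x_i x_j dx] / |K|^{n+2}`. -/
theorem second_moment_randCrossVol
    (n : ℕ) (hn : 0 < n)
    (K : Set (EuclideanSpace ℝ (Fin n)))
    (hK_conv : Convex ℝ K) (hK_comp : IsCompact K)
    (hK_int : (interior K).Nonempty) (hK_symm : K = -K) :
    ∫ x, randCrossVol n K x ^ 2 ∂(jointUnif n n K) =
      (4 ^ n / (n.factorial : ℝ)) *
        (inertiaMatrix n K).det / (volume K).toReal ^ (n + 2) := by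
  have hK0 : volume K ≠ 0 := (Measure.measure_pos_of_nonempty_interior _ hK_int).ne'
  have hKtop : volume K ≠ ⊤ := hK_comp.measure_lt_top.ne
  have hv : (volume K).toReal ≠ 0 := ENNReal.toReal_ne_zero.mpr ⟨hK0, hKtop⟩
  have : IsFiniteMeasure (volume.restrict K) := ⟨by simpa using hK_comp.measure_lt_top⟩
  have : IsFiniteMeasure (unifMeasure n K) :=
    Measure.smul_finite _ (ENNReal.inv_ne_top.mpr hK0)
  have hint : ∀ j k : Fin n, Integrable (fun y : EuclideanSpace ℝ (Fin n) => y j * y k)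
      (unifMeasure n K) := fun j k => by
    have h : IntegrableOn (fun y : EuclideanSpace ℝ (Fin n) => y j * y k) K volume :=
      ContinuousOn.integrableOn_compact hK_comp (by fun_prop)
    exact Integrable.smul_measure h (ENNReal.inv_ne_top.mpr hK0)
  have hmom : (Matrix.of fun j k : Fin n => ∫ y, y j * y k ∂(unifMeasure n K)) =
      (volume K).toReal⁻¹ • inertiaMatrix n K := by
    ext j k
    simp [unifMeasure, inertiaMatrix, integral_smul_measure]
  have hV : ∀ x : Fin n → EuclideanSpace ℝ (Fin n), randCrossVol n K x ^ 2 =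
      (4 ^ n / ((n.factorial : ℝ) ^ 2 * (volume K).toReal ^ 2)) *
        (Matrix.of fun i j => x i j).det ^ 2 := by
    intro x
    rw [randCrossVol, volume_convexHull_range_union_neg hn, ENNReal.toReal_ofReal (by positivity),
      div_pow, mul_pow, sq_abs, div_pow, ← pow_mul, mul_comm n 2, pow_mul]
    norm_num
    ring
  simp_rw [hV]
  rw [integral_const_mul, jointUnif,
    integral_det_sq_pi (unifMeasure n K) (fun (j : Fin n) y => y j) hint, hmom, Matrix.det_smul,
    Fintype.card_fin, inv_pow, pow_add]
  have hfac : (n.factorial : ℝ) ≠ 0 := by positivity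
  field_simp
end

section
/- Let Δₙ be an n-dimensional simplex in ℝⁿ. Then E U_{Δₙ}² = n! / ((n+1)(n+2))ⁿ; equivalently, (E U_{Δₙ}²)^{1/n} = (n!)^{1/n} / ((n+1)(n+2)). -/
open MeasureTheory

section BarycentricMoments

variable {E ι : Type*} [NormedAddCommGroup E] [NormedSpace ℝ E]

/-- The affine change of variables formula, for an unspecified Jacobian. -/
lemma AffineMap.exists_setIntegral_image_eq_mul [FiniteDimensional ℝ E] [MeasurableSpace E] [BorelSpace E]
    (μ : Measure E) [μ.IsAddHaarMeasure] (φ : E →ᵃ[ℝ] E) (hφ : Function.Injective φ) :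
    ∃ c : ℝ, ∀ s : Set E, MeasurableSet s → ∀ f : E → ℝ,
      ∫ x in φ '' s, f x ∂μ = c * ∫ x in s, f (φ x) ∂μ := by
  refine ⟨|(LinearMap.toContinuousLinearMap φ.linear).det|, fun s hs f => ?_⟩
  have hd : ∀ x ∈ s, HasFDerivWithinAt φ (LinearMap.toContinuousLinearMap φ.linear) s x := by
    intro x _
    have h := ((LinearMap.toContinuousLinearMap φ.linear).hasFDerivAt (x := x)).add_const (φ 0)
    refine (h.congr_of_eventuallyEq (Filter.Eventually.of_forall fun y => ?_)).hasFDerivWithinAt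
    simpa using congrFun φ.decomp y
  rw [integral_image_eq_integral_abs_det_fderiv_smul μ hs hd hφ.injOn, ← integral_const_mul]
  simp only [smul_eq_mul]

namespace AffineBasis

/-- The affine map moving every point `x` by `ℓ x` times the edge vector from `b k` to `b j`. -/
noncomputable def moveAlongEdge (b : AffineBasis ι ℝ E) (j k : ι) (ℓ : E →ᵃ[ℝ] ℝ) : E →ᵃ[ℝ] E :=
  AffineMap.id ℝ E + (LinearMap.toSpanSingleton ℝ E (b j - b k)).toAffineMap.comp ℓ

lemma coord_moveAlongEdge [DecidableEq ι] (b : AffineBasis ι ℝ E) (j k i : ι) (ℓ : E →ᵃ[ℝ] ℝ)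
    (x : E) : b.coord i (b.moveAlongEdge j k ℓ x) =
      b.coord i x + ℓ x * ((if i = j then 1 else 0) - (if i = k then 1 else 0)) := by
  have h : b.moveAlongEdge j k ℓ x = (ℓ x • (b j - b k)) +ᵥ x := by
    simp [moveAlongEdge, add_comm]
  have h2 : (b.coord i).linear (b j - b k) = b.coord i (b j) - b.coord i (b k) :=
    (b.coord i).linearMap_vsub (b j) (b k)
  rw [h, AffineMap.map_vadd, map_smul, h2, coord_apply, coord_apply]
  simp [add_comm]

/-- The reflection-like affine involution exchanging the vertices `b j` and `b k`. -/
noncomputable def swapVertices (b : AffineBasis ι ℝ E) (j k : ι) : E →ᵃ[ℝ] E :=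
  b.moveAlongEdge j k (b.coord k - b.coord j)

/-- The affine map sending `b k` to the midpoint of `b j` and `b k`, fixing the other vertices. -/
noncomputable def halveEdge (b : AffineBasis ι ℝ E) (j k : ι) : E →ᵃ[ℝ] E :=
  b.moveAlongEdge j k ((1 / 2 : ℝ) • b.coord k)

section

variable [DecidableEq ι] (b : AffineBasis ι ℝ E) (j k : ι)

lemma coord_swapVertices (i : ι) (x : E) :
    b.coord i (b.swapVertices j k x) = b.coord (Equiv.swap j k i) x := by
  rw [swapVertices, coord_moveAlongEdge, Equiv.swap_apply_def]
  split_ifs <;> simp_all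

lemma coord_halveEdge (i : ι) (x : E) :
    b.coord i (b.halveEdge j k x) = b.coord i x +
      b.coord k x / 2 * ((if i = j then 1 else 0) - (if i = k then 1 else 0)) := by
  rw [halveEdge, coord_moveAlongEdge]
  simp [div_eq_inv_mul]

variable [Finite ι]

lemma swapVertices_swapVertices (x : E) :
    b.swapVertices j k (b.swapVertices j k x) = x :=
  b.ext_elem fun i => by simp [coord_swapVertices]

lemma halveEdge_injective (hjk : j ≠ k) : Function.Injective (b.halveEdge j k) := by
  intro x y hxy
  have h : ∀ i, b.coord i (b.halveEdge j k x) = b.coord i (b.halveEdge j k y) := fun i => by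
    rw [hxy]
  simp only [coord_halveEdge] at h
  have hk : b.coord k x = b.coord k y := by
    have := h k
    simp only [hjk.symm, if_true, if_false] at this
    linarith
  refine b.ext_elem fun i => ?_
  have := h i
  rw [hk] at this
  linarith

lemma image_swapVertices_convexHull :
    b.swapVertices j k '' convexHull ℝ (Set.range b) = convexHull ℝ (Set.range b) := by
  rw [b.convexHull_eq_nonneg_coord]
  refine Set.Subset.antisymm ?_ fun x hx => ⟨b.swapVertices j k x, fun i => ?_, ?_⟩
  · rintro _ ⟨x, hx, rfl⟩ i
    rw [coord_swapVertices]
    exact hx _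
  · rw [coord_swapVertices]
    exact hx _
  · exact b.swapVertices_swapVertices j k x

lemma image_swapVertices_convexHull_inter :
    b.swapVertices j k '' (convexHull ℝ (Set.range b) ∩ {x | b.coord k x ≤ b.coord j x}) =
      convexHull ℝ (Set.range b) ∩ {x | b.coord j x ≤ b.coord k x} := by
  rw [b.convexHull_eq_nonneg_coord]
  refine Set.Subset.antisymm ?_ fun x hx => ⟨b.swapVertices j k x, ⟨fun i => ?_, ?_⟩, ?_⟩
  · rintro _ ⟨x, hx, rfl⟩
    refine ⟨fun i => ?_, ?_⟩
    · rw [coord_swapVertices]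
      exact hx.1 _
    · simpa [coord_swapVertices] using hx.2
  · rw [coord_swapVertices]
    exact hx.1 _
  · simpa [coord_swapVertices] using hx.2
  · exact b.swapVertices_swapVertices j k x

lemma image_halveEdge_convexHull (hjk : j ≠ k) :
    b.halveEdge j k '' convexHull ℝ (Set.range b) =
      convexHull ℝ (Set.range b) ∩ {x | b.coord k x ≤ b.coord j x} := by
  rw [b.convexHull_eq_nonneg_coord]
  ext y
  constructor
  · rintro ⟨x, hx, rfl⟩
    have hk := hx k
    refine ⟨fun i => ?_, ?_⟩
    · have hi := hx i
      rw [coord_halveEdge]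
      split_ifs with h1 h2 h2
      · simpa using hi
      · linarith
      · subst h2
        linarith
      · simpa using hi
    · have hj := hx j
      simp only [Set.mem_ofPred_eq, coord_halveEdge, if_true, hjk, hjk.symm, if_false]
      linarith
  · rintro ⟨hy, hy'⟩
    rw [Set.mem_ofPred_eq] at hy'
    have hc : ∀ i, b.coord i (b.moveAlongEdge j k (-b.coord k) y) = b.coord i y -
        b.coord k y * ((if i = j then 1 else 0) - (if i = k then 1 else 0)) := fun i => by
      rw [coord_moveAlongEdge]
      simp [sub_eq_add_neg]
    refine ⟨b.moveAlongEdge j k (-b.coord k) y, fun i => ?_, b.ext_elem fun i => ?_⟩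
    · have hi := hy i
      have hk := hy k
      rw [hc]
      split_ifs with h1 h2 h2
      · simpa using hi
      · subst h1
        linarith
      · linarith
      · simpa using hi
    · rw [coord_halveEdge, hc, hc]
      simp only [hjk.symm, if_true, if_false]
      ring

end

lemma isCompact_convexHull_range [Finite ι] (b : AffineBasis ι ℝ E) :
    IsCompact (convexHull ℝ (Set.range b)) :=
  (Set.finite_range b).isCompact_convexHull ℝ

variable [MeasurableSpace E]

lemma measure_convexHull_range_pos [Fintype ι] (b : AffineBasis ι ℝ E) (μ : Measure E)
    [μ.IsAddHaarMeasure] : 0 < μ (convexHull ℝ (Set.range b)) :=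
  Measure.measure_pos_of_nonempty_interior _ ⟨_, b.centroid_mem_interior_convexHull⟩

variable [FiniteDimensional ℝ E] [BorelSpace E]

lemma measure_coord_eq_coord [DecidableEq ι] (b : AffineBasis ι ℝ E) (μ : Measure E)
    [μ.IsAddHaarMeasure] {j k : ι} (hjk : j ≠ k) :
    μ {x | b.coord j x = b.coord k x} = 0 := by
  let H : AffineSubspace ℝ E :=
    (AffineSubspace.mk' (0 : ℝ) ⊥).comap (b.coord j - b.coord k)
  have hH : (H : Set E) = {x | b.coord j x = b.coord k x} := by
    ext x
    simp [H, AffineSubspace.mem_mk', sub_eq_zero]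
  rw [← hH]
  refine Measure.addHaar_affineSubspace μ H fun h => ?_
  have : b j ∈ (H : Set E) := by rw [h]; trivial
  rw [hH] at this
  simp [hjk.symm] at this

variable [Fintype ι] [DecidableEq ι] (b : AffineBasis ι ℝ E) (μ : Measure E) [μ.IsAddHaarMeasure]

lemma setIntegral_comp_swapVertices (j k : ι) {s : Set E} (hs : MeasurableSet s) (f : E → ℝ) :
    ∫ x in s, f (b.swapVertices j k x) ∂μ = ∫ x in b.swapVertices j k '' s, f x ∂μ := by
  obtain ⟨c, hc⟩ := AffineMap.exists_setIntegral_image_eq_mul μ (b.swapVertices j k)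
    (Function.Involutive.injective (b.swapVertices_swapVertices j k))
  have hK := b.isCompact_convexHull_range
  have h1 := hc _ hK.measurableSet (fun _ => 1)
  rw [image_swapVertices_convexHull, setIntegral_const, smul_eq_mul, mul_one] at h1
  have hpos : μ.real (convexHull ℝ (Set.range b)) ≠ 0 :=
    (ENNReal.toReal_pos (b.measure_convexHull_range_pos μ).ne' hK.measure_lt_top.ne).ne'
  have hc1 : c = 1 := by
    rw [eq_comm] at h1
    exact (mul_eq_right₀ hpos).1 h1
  rw [hc s hs, hc1, one_mul]

lemma setIntegral_convexHull_eq_half_add {j k : ι} (hjk : j ≠ k) {f : E → ℝ}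
    (hf : Continuous f) :
    ∫ x in convexHull ℝ (Set.range b), f x ∂μ =
      ((∫ x in convexHull ℝ (Set.range b), f (b.halveEdge j k x) ∂μ) +
        ∫ x in convexHull ℝ (Set.range b), f (b.swapVertices j k (b.halveEdge j k x)) ∂μ) / 2 := by
  obtain ⟨c, hc⟩ := AffineMap.exists_setIntegral_image_eq_mul μ (b.halveEdge j k)
    (b.halveEdge_injective j k hjk)
  have hK := b.isCompact_convexHull_range
  have hcont := fun i => continuous_barycentric_coord b i
  have hm1 : MeasurableSet {x | b.coord k x ≤ b.coord j x} :=
    (isClosed_le (hcont k) (hcont j)).measurableSet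
  have hm2 : MeasurableSet {x | b.coord j x ≤ b.coord k x} :=
    (isClosed_le (hcont j) (hcont k)).measurableSet
  have key : ∀ g : E → ℝ, Continuous g → ∫ x in convexHull ℝ (Set.range b), g x ∂μ =
      c * (∫ x in convexHull ℝ (Set.range b), g (b.halveEdge j k x) ∂μ) +
      c * ∫ x in convexHull ℝ (Set.range b), g (b.swapVertices j k (b.halveEdge j k x)) ∂μ := by
    intro g hg
    have hgi : IntegrableOn g (convexHull ℝ (Set.range b)) μ :=
      hg.continuousOn.integrableOn_compact hK
    rw [← hc _ hK.measurableSet g, ← hc _ hK.measurableSet fun x => g (b.swapVertices j k x),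
      image_halveEdge_convexHull b j k hjk,
      setIntegral_comp_swapVertices b μ j k (hK.measurableSet.inter hm1),
      image_swapVertices_convexHull_inter, ← setIntegral_union₀ _
        (hK.measurableSet.inter hm2).nullMeasurableSet (hgi.mono_set Set.inter_subset_left)
        (hgi.mono_set Set.inter_subset_left), ← Set.inter_union_distrib_left]
    · congr 2
      symm
      rw [Set.inter_eq_left]
      exact fun x _ => le_total (b.coord k x) (b.coord j x)
    · refine measure_mono_null ?_ (b.measure_coord_eq_coord μ hjk)
      exact fun x hx => le_antisymm hx.2.2 hx.1.2
  have h1 := key (fun _ => 1) continuous_const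
  rw [setIntegral_const, smul_eq_mul, mul_one] at h1
  have hpos : μ.real (convexHull ℝ (Set.range b)) ≠ 0 :=
    (ENNReal.toReal_pos (b.measure_convexHull_range_pos μ).ne' hK.measure_lt_top.ne).ne'
  have hc1 : c = 1 / 2 := by
    apply mul_right_cancel₀ hpos
    linarith
  rw [key f hf, hc1]
  ring

lemma setIntegral_coord_mul_coord_of_ne {j k : ι} (hjk : j ≠ k) :
    ∫ x in convexHull ℝ (Set.range b), b.coord j x * b.coord k x ∂μ =
      (∫ x in convexHull ℝ (Set.range b), b.coord k x * b.coord k x ∂μ) / 2 := by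
  have hK := b.isCompact_convexHull_range
  have hcont := fun i => continuous_barycentric_coord b i
  have h := b.setIntegral_convexHull_eq_half_add μ hjk ((hcont j).mul (hcont k))
  have hi : ∀ i, IntegrableOn (fun x => b.coord i x * b.coord k x)
      (convexHull ℝ (Set.range b)) μ := fun i =>
    ((hcont i).mul (hcont k)).continuousOn.integrableOn_compact hK
  have h2 : ∀ x, b.coord j (b.halveEdge j k x) * b.coord k (b.halveEdge j k x) =
      1 / 2 * (b.coord j x * b.coord k x) + 1 / 4 * (b.coord k x * b.coord k x) := by
    intro x
    simp only [coord_halveEdge, if_true, hjk, hjk.symm, if_false]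
    ring
  have h3 : ∀ x, b.coord j (b.swapVertices j k (b.halveEdge j k x)) *
      b.coord k (b.swapVertices j k (b.halveEdge j k x)) =
      1 / 2 * (b.coord j x * b.coord k x) + 1 / 4 * (b.coord k x * b.coord k x) := by
    intro x
    rw [← h2, coord_swapVertices, coord_swapVertices, Equiv.swap_apply_left,
      Equiv.swap_apply_right, mul_comm]
  simp only [Pi.mul_apply, h2, h3] at h
  rw [integral_add ((hi j).const_mul _) ((hi k).const_mul _), integral_const_mul,
    integral_const_mul] at h
  linarith

lemma setIntegral_coord_mul_self_eq (j k : ι) :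
    ∫ x in convexHull ℝ (Set.range b), b.coord j x * b.coord j x ∂μ =
      ∫ x in convexHull ℝ (Set.range b), b.coord k x * b.coord k x ∂μ := by
  rcases eq_or_ne j k with rfl | hjk
  · rfl
  have h := b.setIntegral_coord_mul_coord_of_ne μ hjk
  have h' := b.setIntegral_coord_mul_coord_of_ne μ hjk.symm
  simp only [mul_comm (b.coord k _) (b.coord j _)] at h'
  linarith

/-- The second moments of the barycentric coordinates over a simplex. -/
lemma setIntegral_coord_mul_coord (j k : ι) :
    ∫ x in convexHull ℝ (Set.range b), b.coord j x * b.coord k x ∂μ =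
      (if j = k then 2 else 1) * μ.real (convexHull ℝ (Set.range b)) /
        (Fintype.card ι * (Fintype.card ι + 1)) := by
  have hK := b.isCompact_convexHull_range
  have hcont := fun i => continuous_barycentric_coord b i
  have hi : ∀ i l, IntegrableOn (fun x => b.coord i x * b.coord l x)
      (convexHull ℝ (Set.range b)) μ := fun i l =>
    ((hcont i).mul (hcont l)).continuousOn.integrableOn_compact hK
  set a := ∫ x in convexHull ℝ (Set.range b), b.coord k x * b.coord k x ∂μ with ha
  have hall : ∀ i l, ∫ x in convexHull ℝ (Set.range b), b.coord i x * b.coord l x ∂μ =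
      a / 2 + if i = l then a / 2 else 0 := by
    intro i l
    split_ifs with h
    · rw [h, b.setIntegral_coord_mul_self_eq μ l k]
      ring
    · rw [b.setIntegral_coord_mul_coord_of_ne μ h, b.setIntegral_coord_mul_self_eq μ l k]
      ring
  have hsum : ∑ i, ∑ l, ∫ x in convexHull ℝ (Set.range b), b.coord i x * b.coord l x ∂μ =
      μ.real (convexHull ℝ (Set.range b)) := by
    simp_rw [← integral_finsetSum Finset.univ fun l _ => hi _ l]
    rw [← integral_finsetSum Finset.univ fun i _ => integrable_finsetSum _ fun l _ => hi i l]
    simp [← Finset.mul_sum]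
  have : Nonempty ι := ⟨k⟩
  have hcard : (Fintype.card ι : ℝ) ≠ 0 :=
    Nat.cast_ne_zero.2 (Fintype.card_ne_zero (α := ι))
  have hcard' : (Fintype.card ι : ℝ) + 1 ≠ 0 := by positivity
  simp_rw [hall, Finset.sum_add_distrib] at hsum
  simp at hsum
  rw [hall, ← hsum]
  split_ifs <;> field_simp <;> ring

end AffineBasis

end BarycentricMoments

section GramDeterminant

variable {ι Ω : Type*} [Fintype ι] [DecidableEq ι]

/-- The second moment of the determinant of a random matrix with i.i.d. rows. -/
lemma integral_sq_det_pi [MeasurableSpace Ω] (ν : Measure Ω) [SigmaFinite ν]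
    (f : ι → Ω → ℝ) (hf : ∀ j k, Integrable (fun x => f j x * f k x) ν) :
    ∫ x, (Matrix.of fun i j => f j (x i)).det ^ 2 ∂(Measure.pi fun _ : ι => ν) =
      (Fintype.card ι).factorial * (Matrix.of fun j k => ∫ x, f j x * f k x ∂ν).det := by
  have hexp : ∀ x : ι → Ω, (Matrix.of fun i j => f j (x i)).det ^ 2 =
      ∑ σ : Equiv.Perm ι, ∑ τ : Equiv.Perm ι,
        ((Equiv.Perm.sign σ : ℤ) : ℝ) * ((Equiv.Perm.sign τ : ℤ) : ℝ) *
          ∏ i, (f (σ i) (x i) * f (τ i) (x i)) := by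
    intro x
    rw [← Matrix.det_transpose, Matrix.det_apply', sq, Finset.sum_mul_sum]
    refine Finset.sum_congr rfl fun σ _ => Finset.sum_congr rfl fun τ _ => ?_
    simp only [Matrix.transpose_apply, Matrix.of_apply, Finset.prod_mul_distrib]
    ring
  have hint : ∀ σ τ : Equiv.Perm ι, Integrable (fun x : ι → Ω =>
      ((Equiv.Perm.sign σ : ℤ) : ℝ) * ((Equiv.Perm.sign τ : ℤ) : ℝ) *
        ∏ i, (f (σ i) (x i) * f (τ i) (x i))) (Measure.pi fun _ : ι => ν) := fun σ τ =>
    (Integrable.fintype_prod (f := fun i y => f (σ i) y * f (τ i) y)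
      fun i => hf (σ i) (τ i)).const_mul _
  simp_rw [hexp]
  rw [integral_finsetSum _ fun σ _ => integrable_finsetSum _ fun τ _ => hint σ τ]
  have hσ : ∀ σ : Equiv.Perm ι, ∫ x : ι → Ω, ∑ τ : Equiv.Perm ι,
      ((Equiv.Perm.sign σ : ℤ) : ℝ) * ((Equiv.Perm.sign τ : ℤ) : ℝ) *
        ∏ i, (f (σ i) (x i) * f (τ i) (x i)) ∂(Measure.pi fun _ : ι => ν) =
      (Matrix.of fun j k => ∫ x, f j x * f k x ∂ν).det := by
    intro σ
    rw [integral_finsetSum _ fun τ _ => hint σ τ]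
    have hsq : ((Equiv.Perm.sign σ : ℤ) : ℝ) * ((Equiv.Perm.sign σ : ℤ) : ℝ) = 1 := by
      rw [← Int.cast_mul, ← Units.val_mul, Int.units_mul_self, Units.val_one, Int.cast_one]
    rw [← one_mul (Matrix.det _), ← hsq, mul_assoc, ← Matrix.det_permute,
      ← Matrix.det_transpose, Matrix.det_apply', Finset.mul_sum]
    refine Finset.sum_congr rfl fun τ _ => ?_
    rw [integral_const_mul,
      integral_fintype_prod_eq_prod (f := fun i y => f (σ i) y * f (τ i) y), mul_assoc]
    simp [Matrix.transpose_apply, mul_comm (f (σ _) _)]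
  rw [Finset.sum_congr rfl fun σ _ => hσ σ]
  simp [Fintype.card_perm]

/-- The determinant of `c (I + J)`, where `J` is the all-ones matrix. -/
lemma det_ite_two_one_mul (c : ℝ) :
    (Matrix.of fun j k : ι => (if j = k then 2 else 1) * c).det =
      (Fintype.card ι + 1) * c ^ Fintype.card ι := by
  have h : (Matrix.of fun j k : ι => (if j = k then 2 else 1) * c) =
      c • (1 + Matrix.replicateCol Unit (fun _ : ι => (1 : ℝ)) *
        Matrix.replicateRow Unit (fun _ : ι => (1 : ℝ))) := by
    ext j k
    simp only [Matrix.of_apply, Matrix.smul_apply, Matrix.add_apply, Matrix.one_apply,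
      Matrix.mul_apply, Matrix.replicateCol_apply, Matrix.replicateRow_apply, smul_eq_mul]
    split_ifs
    · norm_num [mul_comm]
    · simp
  rw [h, Matrix.det_smul, Matrix.det_one_add_replicateCol_mul_replicateRow]
  simp [dotProduct]
  ring

end GramDeterminant

namespace AffineBasis

variable {E : Type*} [NormedAddCommGroup E] [NormedSpace ℝ E] {n : ℕ}

/-- Edge vectors at the zeroth vertex, as a basis indexed by `Fin n`. -/
noncomputable def edgeBasis (b : AffineBasis (Fin (n + 1)) ℝ E) : Module.Basis (Fin n) ℝ E :=
  (b.basisOf 0).reindex (finSuccAboveEquiv 0).symm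

lemma edgeBasis_apply (b : AffineBasis (Fin (n + 1)) ℝ E) (i : Fin n) :
    b.edgeBasis i = b i.succ - b 0 := by
  rw [edgeBasis, Module.Basis.reindex_apply, basisOf_apply]
  rfl

lemma edgeBasis_repr_sub (b : AffineBasis (Fin (n + 1)) ℝ E) (x y : E) (i : Fin n) :
    b.edgeBasis.repr (x - y) i = b.coord i.succ x - b.coord i.succ y := by
  have h : b.edgeBasis.coord i = (b.coord i.succ).linear := by
    refine b.edgeBasis.ext fun j => ?_
    have h2 : (b.coord i.succ).linear (b j.succ - b 0) =
        b.coord i.succ (b j.succ) - b.coord i.succ (b 0) :=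
      (b.coord i.succ).linearMap_vsub _ _
    rw [Module.Basis.coord_apply, Module.Basis.repr_self, edgeBasis_apply, h2, coord_apply,
      coord_apply]
    simp [Finsupp.single_apply, eq_comm]
  rw [← Module.Basis.coord_apply, h]
  exact (b.coord i.succ).linearMap_vsub x y

lemma det_toMatrix_eq_det_sub (b : AffineBasis (Fin (n + 1)) ℝ E) (x : Fin (n + 1) → E) :
    (b.toMatrix x).det = (Matrix.of fun i j : Fin n =>
      b.coord j.succ (x i.succ) - b.coord j.succ (x 0)).det := by
  have h1 := Matrix.det_updateCol_sum (b.toMatrix x) 0 (fun _ => (1 : ℝ))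
  simp only [one_smul, toMatrix_apply, sum_coord_apply_eq_one] at h1
  let B : Matrix (Fin (n + 1)) (Fin (n + 1)) ℝ := Matrix.of fun i j =>
    Fin.cases (Fin.cases 1 (fun _ => 0) i) (fun j => Fin.cases (b.coord j.succ (x 0))
      (fun i => b.coord j.succ (x i.succ) - b.coord j.succ (x 0)) i) j
  rw [← h1, Matrix.det_eq_of_forall_row_eq_smul_add_const (B := B)
    (fun i => if i = 0 then 0 else 1) 0 (by simp)]
  · rw [Matrix.det_succ_column_zero, Fin.sum_univ_succ]
    simp [B, Matrix.submatrix]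
  · intro i j
    refine Fin.cases ?_ (fun i => ?_) i <;> refine Fin.cases ?_ (fun j => ?_) j <;>
      simp [B, toMatrix_apply]

variable [MeasurableSpace E] [BorelSpace E] [FiniteDimensional ℝ E]

lemma measure_convexHull_range_eq_abs_det (b : AffineBasis (Fin (n + 1)) ℝ E) (μ : Measure E)
    [μ.IsAddHaarMeasure] (x : Fin (n + 1) → E) :
    μ (convexHull ℝ (Set.range x)) =
      ENNReal.ofReal |(b.toMatrix x).det| * μ (convexHull ℝ (Set.range b)) := by
  let L : E →ₗ[ℝ] E := b.edgeBasis.constr ℝ fun i => x i.succ - x 0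
  have hL : ∀ i : Fin n, L (b i.succ - b 0) = x i.succ - x 0 := fun i => by
    rw [← edgeBasis_apply]
    exact b.edgeBasis.constr_basis ℝ _ i
  have hdet : (b.toMatrix x).det = LinearMap.det L := by
    rw [det_toMatrix_eq_det_sub, ← Matrix.det_transpose, ← LinearMap.det_toMatrix b.edgeBasis]
    congr 1
    ext i j
    rw [LinearMap.toMatrix_apply, edgeBasis_apply, hL, edgeBasis_repr_sub]
    rfl
  let φ : E →ᵃ[ℝ] E := L.toAffineMap + AffineMap.const ℝ E (x 0 - L (b 0))
  have hφ : ∀ i, φ (b i) = x i := by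
    intro i
    have h0 : φ (b i) = L (b i - b 0) + x 0 := by
      simp only [φ, AffineMap.coe_add, Pi.add_apply, LinearMap.coe_toAffineMap,
        AffineMap.const_apply, map_sub]
      abel
    rw [h0]
    refine Fin.cases (by simp) (fun i => ?_) i
    rw [hL, sub_add_cancel]
  have himage : convexHull ℝ (Set.range x) =
      (fun y => y + (x 0 - L (b 0))) '' (L '' convexHull ℝ (Set.range b)) := by
    have hr : Set.range x = φ '' Set.range b := by
      rw [← Set.range_comp]
      exact congrArg Set.range (funext fun i => (hφ i).symm)
    rw [hr, ← AffineMap.image_convexHull, Set.image_image]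
    rfl
  rw [himage, Set.image_add_right, measure_preimage_add_right, Measure.addHaar_image_linearMap,
    hdet]

end AffineBasis

/-- If `Δₙ ⊆ ℝⁿ` is an `n`-dimensional simplex (the convex hull of `n+1` affinely
independent points), then `𝔼 U_{Δₙ}² = n! / ((n+1)(n+2))ⁿ`. -/
theorem second_moment_randSimplexVol_simplex
    (n : ℕ) (hn : 0 < n)
    (v : Fin (n + 1) → EuclideanSpace ℝ (Fin n))
    (hv : AffineIndependent ℝ v) :
    ∫ x, randSimplexVol n (convexHull ℝ (Set.range v)) x ^ 2
        ∂(jointUnif n (n + 1) (convexHull ℝ (Set.range v))) =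
      (n.factorial : ℝ) / ((n + 1 : ℝ) * (n + 2 : ℝ)) ^ n := by
  have hspan : affineSpan ℝ (Set.range v) = ⊤ := by
    rw [hv.affineSpan_eq_top_iff_card_eq_finrank_add_one]
    simp
  let b : AffineBasis (Fin (n + 1)) ℝ (EuclideanSpace ℝ (Fin n)) := ⟨v, hv, hspan⟩
  change ∫ x, randSimplexVol n (convexHull ℝ (Set.range b)) x ^ 2
    ∂(jointUnif n (n + 1) (convexHull ℝ (Set.range b))) = _
  have hK := b.isCompact_convexHull_range
  have hpos := b.measure_convexHull_range_pos volume
  have hV : volume.real (convexHull ℝ (Set.range b)) ≠ 0 :=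
    (ENNReal.toReal_pos hpos.ne' hK.measure_lt_top.ne).ne'
  have hU : ∀ x, randSimplexVol n (convexHull ℝ (Set.range b)) x ^ 2 =
      (Matrix.of fun i j => b.coord j (x i)).det ^ 2 := by
    intro x
    have h : randSimplexVol n (convexHull ℝ (Set.range b)) x = |(b.toMatrix x).det| := by
      rw [randSimplexVol, b.measure_convexHull_range_eq_abs_det volume x, ENNReal.toReal_mul,
        ENNReal.toReal_ofReal (abs_nonneg _)]
      exact mul_div_cancel_right₀ _ hV
    rw [h, sq_abs]
    rfl
  have hinv : (volume (convexHull ℝ (Set.range b)))⁻¹ ≠ ⊤ := ENNReal.inv_ne_top.2 hpos.ne'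
  have hint : ∀ j k, IntegrableOn (fun x => b.coord j x * b.coord k x)
      (convexHull ℝ (Set.range b)) volume := fun j k =>
    ((continuous_barycentric_coord b j).mul
      (continuous_barycentric_coord b k)).continuousOn.integrableOn_compact hK
  have : IsFiniteMeasure (volume.restrict (convexHull ℝ (Set.range b))) :=
    ⟨by simpa using hK.measure_lt_top⟩
  have : IsFiniteMeasure (unifMeasure n (convexHull ℝ (Set.range b))) :=
    Measure.smul_finite _ hinv
  have hmom : ∀ j k, ∫ x, b.coord j x * b.coord k x
      ∂(unifMeasure n (convexHull ℝ (Set.range b))) =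
      (if j = k then 2 else 1) * (1 / ((n + 1 : ℝ) * (n + 2 : ℝ))) := by
    intro j k
    rw [unifMeasure, integral_smul_measure, b.setIntegral_coord_mul_coord volume j k,
      ENNReal.toReal_inv, smul_eq_mul, Fintype.card_fin]
    change (volume.real (convexHull ℝ (Set.range b)))⁻¹ * _ = _
    push_cast
    rw [show (n : ℝ) + 1 + 1 = n + 2 by ring]
    field_simp
  simp_rw [hU, jointUnif]
  rw [integral_sq_det_pi (unifMeasure n (convexHull ℝ (Set.range b))) (fun j => b.coord j)
    fun j k => (hint j k).smul_measure hinv]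
  simp_rw [hmom]
  rw [det_ite_two_one_mul, Fintype.card_fin, Nat.factorial_succ]
  push_cast
  have hn1 : (n : ℝ) + 1 ≠ 0 := by positivity
  have hn2 : (n : ℝ) + 2 ≠ 0 := by positivity
  rw [div_pow, one_pow, pow_succ ((n + 1 : ℝ) * (n + 2 : ℝ))]
  field_simp
  ring
end
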